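/- arXiv:2510.21327 — 12 statements merged into one kernel-verified Lean document; each statement's English description precedes it below -/
import Mathlib

section
/- Let G be a finite simple graph in which every edge is assigned a type, either C or O. Then there exists a red-blue labeling of the darts of G that is consistent with the types and such that every vertex v satisfies d_red(v) ∈ [deg(v)/2 − 1, deg(v)/2 + 1] and d_blue(v) ∈ [deg(v)/2 − 1, deg(v)/2 + 1]. -/
inductive EdgeType where
  | C : EdgeType
  | O : EdgeType

/-- The number of darts at `v` whose label under `ℓ` is `b`. -/
def dartCount {V : Type} [Fintype V] [DecidableEq V] (G : SimpleGraph V)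
    [DecidableRel G.Adj] (ℓ : G.Dart → Bool) (v : V) (b : Bool) : ℕ :=
  (Finset.univ.filter (fun d : G.Dart => d.fst = v ∧ ℓ d = b)).card

/-- The vector `±e_a ± e_b` recording the contributions of the two ends `a`, `b` of an edge
(possibly a loop) to the discrepancies of the vertices. -/
def IsSignedEdge {V : Type*} [DecidableEq V] (f : V → ℤ) : Prop :=
  ∃ (a b : V) (ε δ : ℤˣ), f = Pi.single a (ε : ℤ) + Pi.single b (δ : ℤ)

namespace IsSignedEdge

variable {V : Type*} [DecidableEq V] {f g : V → ℤ}

lemma abs_le_two (hf : IsSignedEdge f) (v : V) : |f v| ≤ 2 := by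
  obtain ⟨a, b, ε, δ, rfl⟩ := hf
  rcases Int.units_eq_one_or ε with rfl | rfl <;> rcases Int.units_eq_one_or δ with rfl | rfl <;>
    simp only [Pi.add_apply, Pi.single_apply] <;> split_ifs <;> simp

lemma exists_eq_single_add (hf : IsSignedEdge f) {v : V} (hv : f v ≠ 0) :
    ∃ (a : V) (ε δ : ℤˣ), f = Pi.single v (ε : ℤ) + Pi.single a (δ : ℤ) := by
  obtain ⟨a, b, ε, δ, rfl⟩ := hf
  by_cases ha : v = a
  · subst ha
    exact ⟨b, ε, δ, rfl⟩
  by_cases hb : v = b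
  · subst hb
    exact ⟨a, δ, ε, add_comm _ _⟩
  · simp [ha, hb] at hv

/-- Two edges sharing a vertex can be spliced into one edge by cancelling their contributions
at that vertex. -/
lemma exists_splice (hf : IsSignedEdge f) (hg : IsSignedEdge g) {v : V} (hfv : f v ≠ 0)
    (hgv : g v ≠ 0) : ∃ c : ℤˣ, IsSignedEdge (f + (c : ℤ) • g) := by
  obtain ⟨a, ε, δ, rfl⟩ := hf.exists_eq_single_add hfv
  obtain ⟨b, ε', δ', rfl⟩ := hg.exists_eq_single_add hgv
  refine ⟨-(ε * ε'), a, b, δ, -(ε * ε') * δ', ?_⟩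
  ext w
  rcases Int.units_eq_one_or ε with rfl | rfl <;> rcases Int.units_eq_one_or ε' with rfl | rfl <;>
    simp [Pi.single_neg] <;> ring

end IsSignedEdge

/-- Finitely many signed edges can be given signs so that every vertex has discrepancy at most
two. -/
lemma exists_signs_abs_sum_le_two {V ι : Type*} [DecidableEq V] [DecidableEq ι] (S : Finset ι)
    (f : ι → V → ℤ) (hf : ∀ i ∈ S, IsSignedEdge (f i)) :
    ∃ s : ι → ℤˣ, ∀ v, |∑ i ∈ S, (s i : ℤ) * f i v| ≤ 2 := by
  induction hn : S.card generalizing S f with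
  | zero => exact ⟨1, by simp [Finset.card_eq_zero.mp hn]⟩
  | succ n ih =>
    by_cases h : ∃ i ∈ S, ∃ j ∈ S, i ≠ j ∧ ∃ v, f i v ≠ 0 ∧ f j v ≠ 0
    · obtain ⟨i, hi, j, hj, hij, v, hiv, hjv⟩ := h
      obtain ⟨c, hc⟩ := (hf i hi).exists_splice (hf j hj) hiv hjv
      have hi' : i ∈ S.erase j := Finset.mem_erase.mpr ⟨hij, hi⟩
      obtain ⟨s, hs⟩ := ih (S.erase j) (Function.update f i (f i + (c : ℤ) • f j))
        (fun k hk => by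
          by_cases hki : k = i
          · subst hki
            simpa using hc
          · simpa [hki] using hf k (Finset.mem_of_mem_erase hk))
        (by rw [Finset.card_erase_of_mem hj, hn]; rfl)
      refine ⟨Function.update s j (s i * c), fun w => ?_⟩
      convert hs w using 2
      rw [← Finset.add_sum_erase _ _ hj, ← Finset.add_sum_erase _ _ hi',
        ← Finset.add_sum_erase _ _ hi', ← add_assoc]
      congr 1
      · simp [hij]
        ring
      · refine Finset.sum_congr rfl fun k hk => ?_
        have hki : k ≠ i := Finset.ne_of_mem_erase hk
        have hkj : k ≠ j := Finset.ne_of_mem_erase (Finset.mem_of_mem_erase hk)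
        simp [hki, hkj]
    · push Not at h
      refine ⟨1, fun v => ?_⟩
      by_cases hv : ∃ i ∈ S, f i v ≠ 0
      · obtain ⟨i, hi, hiv⟩ := hv
        rw [Finset.sum_eq_single_of_mem i hi fun j hj hji => by simp [h i hi j hj hji.symm v hiv]]
        simpa using (hf i hi).abs_le_two v
      · push Not at hv
        rw [Finset.sum_eq_zero fun i hi => by simp [hv i hi]]
        simp

/-- The sign relating the two darts of an edge of a given type. -/
def EdgeType.sign : EdgeType → ℤˣ
  | .C => 1
  | .O => -1

/-- Darts can be signed so that opposite darts differ by a prescribed sign and every vertex has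
discrepancy at most two. -/
lemma SimpleGraph.exists_dart_signs {V : Type*} [Fintype V] [DecidableEq V] (G : SimpleGraph V)
    [DecidableRel G.Adj] (τ : Sym2 V → ℤˣ) :
    ∃ x : G.Dart → ℤˣ, (∀ d, x d.symm = τ d.edge * x d) ∧
      ∀ v, |∑ d : G.Dart with d.fst = v, (x d : ℤ)| ≤ 2 := by
  have hr : ∀ e : G.edgeSet, ∃ d : G.Dart, d.edge = e := by
    rintro ⟨e, he⟩
    induction e with | h a b => exact ⟨⟨(a, b), he⟩, rfl⟩
  choose r hr using hr
  obtain ⟨s, hs⟩ := exists_signs_abs_sum_le_two (Finset.univ : Finset G.edgeSet)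
    (fun e => Pi.single (r e).fst ((1 : ℤˣ) : ℤ) + Pi.single (r e).snd (τ e : ℤ))
    (fun e _ => ⟨_, _, _, _, rfl⟩)
  let E : G.Dart → G.edgeSet := fun d => ⟨d.edge, d.edge_mem⟩
  have hE : ∀ d : G.Dart, E d.symm = E d := fun d => Subtype.ext d.edge_symm
  have hEr : ∀ e, E (r e) = e := fun e => Subtype.ext (hr e)
  let x : G.Dart → ℤˣ := fun d => s (E d) * if d = r (E d) then 1 else τ d.edge
  refine ⟨x, fun d => ?_, fun v => ?_⟩
  · have hd : d = r (E d) ∨ d = (r (E d)).symm :=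
      (G.dart_edge_eq_iff _ _).mp (hr (E d)).symm
    rcases hd with hd | hd
    · have hd' : d.symm ≠ r (E d) := by
        rw [← hd]
        exact d.symm_ne
      simp only [x, hE, if_pos hd, if_neg hd', SimpleGraph.Dart.edge_symm, mul_one]
      exact mul_comm _ _
    · have hd' : d.symm = r (E d) := by rw [hd, SimpleGraph.Dart.symm_symm, ← hd]
      have hd'' : d ≠ r (E d) := by
        rw [← hd']
        exact d.symm_ne.symm
      simp only [x, hE, if_pos hd', if_neg hd'']
      rw [mul_left_comm, Int.units_mul_self]
  · convert hs v using 2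
    rw [Finset.sum_filter, ← Finset.sum_fiberwise_of_maps_to (g := E) (fun d _ => Finset.mem_univ _)]
    refine Finset.sum_congr rfl fun e _ => ?_
    have hfib : (Finset.univ.filter fun d : G.Dart => E d = e) = {r e, (r e).symm} := by
      ext d
      simp only [Finset.mem_filter, Finset.mem_univ, true_and, Finset.mem_insert,
        Finset.mem_singleton]
      rw [← G.dart_edge_eq_iff, hr e, Subtype.ext_iff]
    rw [hfib, Finset.sum_pair (r e).symm_ne.symm]
    have hne := (r e).symm_ne
    simp [x, hE, hEr, hne, hr, Pi.single_apply, eq_comm (a := v), mul_add]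


/-- For every finite simple graph whose edges are typed `C` or `O`,
there is a red-blue labeling of the darts, consistent with the types, such that every
vertex `v` has both its red count and its blue count in `[deg(v)/2 - 1, deg(v)/2 + 1]`. -/
theorem balanced_dart_labeling {V : Type} [Fintype V] [DecidableEq V]
    (G : SimpleGraph V) [DecidableRel G.Adj] (t : Sym2 V → EdgeType) :
    ∃ ℓ : G.Dart → Bool,
      (∀ d : G.Dart,
        (t d.edge = EdgeType.C → ℓ d = ℓ d.symm) ∧
        (t d.edge = EdgeType.O → ℓ d ≠ ℓ d.symm)) ∧
      (∀ v : V,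
        (dartCount G ℓ v true : ℝ) ∈
          Set.Icc ((G.degree v : ℝ) / 2 - 1) ((G.degree v : ℝ) / 2 + 1) ∧
        (dartCount G ℓ v false : ℝ) ∈
          Set.Icc ((G.degree v : ℝ) / 2 - 1) ((G.degree v : ℝ) / 2 + 1)) := by
  classical
  obtain ⟨x, hx, hdisc⟩ := G.exists_dart_signs fun e => (t e).sign
  have hsymm : ∀ d : G.Dart, x d.symm = (t d.edge).sign * x d := hx
  refine ⟨fun d => decide (x d = 1), fun d => ⟨fun h => ?_, fun h => ?_⟩, fun v => ?_⟩
  · simp [hsymm, h, EdgeType.sign]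
  · rcases Int.units_eq_one_or (x d) with hd | hd <;> simp [hsymm, h, EdgeType.sign, hd]
  · set ℓ : G.Dart → Bool := fun d => decide (x d = 1) with hℓ
    have hsum : dartCount G ℓ v true + dartCount G ℓ v false = G.degree v := by
      rw [← G.dart_fst_fiber_card_eq_degree v, ← Finset.card_filter_add_card_filter_not
        (s := Finset.univ.filter fun d : G.Dart => d.fst = v) (fun d => ℓ d = true)]
      simp [dartCount, Finset.filter_filter]
    have hdiff : ∑ d : G.Dart with d.fst = v, (x d : ℤ) =
        (dartCount G ℓ v true : ℤ) - dartCount G ℓ v false := by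
      simp only [dartCount, Finset.card_filter, Finset.sum_filter, Nat.cast_sum,
        ← Finset.sum_sub_distrib]
      refine Finset.sum_congr rfl fun d _ => ?_
      rcases Int.units_eq_one_or (x d) with hd | hd <;> by_cases hv : d.fst = v <;>
        simp [hℓ, hd, hv]
    have hle := hdisc v
    rw [hdiff, abs_le] at hle
    obtain ⟨h₁, h₂⟩ := hle
    have h₁' : (-2 : ℝ) ≤ dartCount G ℓ v true - dartCount G ℓ v false := by exact_mod_cast h₁
    have h₂' : (dartCount G ℓ v true : ℝ) - dartCount G ℓ v false ≤ 2 := by exact_mod_cast h₂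
    rw [← hsum]
    push_cast
    refine ⟨⟨?_, ?_⟩, ⟨?_, ?_⟩⟩ <;> linarith
end

section
/- Let G be a finite simple graph. Then there exists an edge 2-coloring of G with colors red and blue such that every vertex v satisfies d_red(v) ∈ {⌊deg(v)/2⌋, ⌊deg(v)/2⌋ + 1} and d_blue(v) ∈ {⌈deg(v)/2⌉ − 1, ⌈deg(v)/2⌉}. -/
/-- The number of edges incident to `v` that the edge 2-coloring `c` colors with
color `b` (`true` = red, `false` = blue). -/
def edgeColorCount {V : Type} [Fintype V] [DecidableEq V] (G : SimpleGraph V)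
    [DecidableRel G.Adj] (c : Sym2 V → Bool) (v : V) (b : Bool) : ℕ :=
  ((G.incidenceFinset v).filter (fun e => c e = b)).card

/-- The sum of the signs `σ e` over the members `e` of `E` incident to `v`. -/
def signedDegree {V : Type} [DecidableEq V] (σ : Sym2 V → ℤ) (E : Finset (Sym2 V)) (v : V) : ℤ :=
  ∑ e ∈ E, if v ∈ e then σ e else 0

/-- The distance from an integer to the interval `[-1, 2]`. -/
def imbalance (x : ℤ) : ℕ := (x - 2).toNat + (-1 - x).toNat

/-- A maximal alternating trail `T` in `E` that starts at `w` with an edge of sign `s`; it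
ends at `u` with an edge of sign `t` (if it is empty, then `u = w` and `t = -s`). -/
lemma exists_maximal_alternating_trail {V : Type} [DecidableEq V] (σ : Sym2 V → ℤ)
    (E : Finset (Sym2 V)) (hE : ∀ e ∈ E, ¬ e.IsDiag) (w : V) (s : ℤ) (hs : s = 1 ∨ s = -1) :
    ∃ T ⊆ E, ∃ u t, (t = 1 ∨ t = -1) ∧
      (∀ v, signedDegree σ T v = (if v = w then s else 0) + (if v = u then t else 0)) ∧
      ∀ e ∈ E \ T, u ∈ e → σ e ≠ -t := by
  induction E using Finset.strongInduction generalizing w s with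
  | H E ih =>
    by_cases h : ∃ e ∈ E, w ∈ e ∧ σ e = s
    · obtain ⟨e, he, hwe, hσ⟩ := h
      obtain ⟨w', rfl⟩ := Sym2.mem_iff_exists.mp hwe
      have hne : w ≠ w' := hE _ he
      obtain ⟨T, hT, u, t, ht, hdeg, hmax⟩ := ih (E.erase s(w, w')) (Finset.erase_ssubset he)
        (fun e h => hE e (Finset.mem_of_mem_erase h)) w' (-s) (by omega)
      have heT : s(w, w') ∉ T := fun h => Finset.notMem_erase _ _ (hT h)
      refine ⟨insert s(w, w') T,
        Finset.insert_subset he (hT.trans (Finset.erase_subset _ _)), u, t, ht, fun v => ?_,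
        fun e h => hmax e (by simp_all)⟩
      have hv := hdeg v
      unfold signedDegree at hv ⊢
      rw [Finset.sum_insert heT, hv, hσ]
      by_cases h₁ : v = w <;> by_cases h₂ : v = w' <;> simp_all
    · push Not at h
      refine ⟨∅, by simp, w, -s, by omega, fun v => ?_, fun e he hw => ?_⟩
      · by_cases hv : v = w <;> simp [signedDegree, hv]
      · simpa using h e (by simpa using he) hw

/-- Reversing the signs on `T ⊆ E` lowers each signed degree by twice its contribution
from `T`. -/
lemma signedDegree_flip {V : Type} [DecidableEq V] (σ : Sym2 V → ℤ) {E T : Finset (Sym2 V)}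
    (hT : T ⊆ E) (v : V) :
    signedDegree (fun e => if e ∈ T then -σ e else σ e) E v =
      signedDegree σ E v - 2 * signedDegree σ T v := by
  have hsum : signedDegree σ T v = ∑ e ∈ E, if e ∈ T then (if v ∈ e then σ e else 0) else 0 := by
    rw [← Finset.sum_filter, Finset.filter_mem_eq_inter, Finset.inter_eq_right.mpr hT,
      signedDegree]
  rw [hsum, signedDegree, signedDegree, Finset.mul_sum, ← Finset.sum_sub_distrib]
  refine Finset.sum_congr rfl fun e _ => ?_
  split_ifs <;> ring

/-- The end `u` of a maximal trail has signed degree at least that of the trail, in the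
direction `t` of its last edge. -/
lemma mul_signedDegree_le_of_maximal {V : Type} [DecidableEq V] {σ : Sym2 V → ℤ}
    (hσ : ∀ e, σ e = 1 ∨ σ e = -1) {E T : Finset (Sym2 V)} (hT : T ⊆ E) {u : V} {t : ℤ}
    (ht : t = 1 ∨ t = -1) (hmax : ∀ e ∈ E \ T, u ∈ e → σ e ≠ -t) :
    t * signedDegree σ T u ≤ t * signedDegree σ E u := by
  unfold signedDegree
  rw [← Finset.sum_sdiff hT, mul_add, le_add_iff_nonneg_left, Finset.mul_sum]
  refine Finset.sum_nonneg fun e he => ?_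
  split_ifs with hu
  · have := hmax e he hu
    rcases ht with rfl | rfl <;> rcases hσ e with h | h <;> simp_all
  · simp

/-- Signs can be changed so as to decrease the total imbalance if some vertex is not balanced. -/
lemma exists_imbalance_lt {V : Type} [Fintype V] [DecidableEq V] {σ : Sym2 V → ℤ}
    (hσ : ∀ e, σ e = 1 ∨ σ e = -1) {E : Finset (Sym2 V)} (hE : ∀ e ∈ E, ¬ e.IsDiag) {w : V}
    (hw : imbalance (signedDegree σ E w) ≠ 0) :
    ∃ σ' : Sym2 V → ℤ, (∀ e, σ' e = 1 ∨ σ' e = -1) ∧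
      ∑ v, imbalance (signedDegree σ' E v) < ∑ v, imbalance (signedDegree σ E v) := by
  obtain ⟨s, hs, hsw⟩ : ∃ s : ℤ, (s = 1 ∨ s = -1) ∧
      (s = 1 ∧ 3 ≤ signedDegree σ E w ∨ s = -1 ∧ signedDegree σ E w ≤ -2) := by
    unfold imbalance at hw
    by_cases h : 3 ≤ signedDegree σ E w
    · exact ⟨1, by omega, by omega⟩
    · exact ⟨-1, by omega, by omega⟩
  obtain ⟨T, hT, u, t, ht, hdeg, hmax⟩ := exists_maximal_alternating_trail σ E hE w s hs
  have hle := mul_signedDegree_le_of_maximal hσ hT ht hmax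
  have hu := hdeg u
  have key : ∀ v, imbalance (signedDegree (fun e => if e ∈ T then -σ e else σ e) E v) ≤
      imbalance (signedDegree σ E v) ∧ (v = w →
        imbalance (signedDegree (fun e => if e ∈ T then -σ e else σ e) E v) <
          imbalance (signedDegree σ E v)) := by
    intro v
    rw [signedDegree_flip σ hT, hdeg v]
    unfold imbalance
    rw [hu] at hle
    by_cases hvw : v = w <;> by_cases hvu : v = u <;> by_cases huw : u = w <;>
      rcases hs with rfl | rfl <;> rcases ht with rfl | rfl <;> simp_all <;> omega
  refine ⟨fun e => if e ∈ T then -σ e else σ e, fun e => ?_,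
    Finset.sum_lt_sum (fun v _ => (key v).1) ⟨w, Finset.mem_univ w, (key w).2 rfl⟩⟩
  have := hσ e
  dsimp only
  split_ifs <;> omega

lemma exists_signs_signedDegree_mem_Icc {V : Type} [Fintype V] [DecidableEq V]
    (E : Finset (Sym2 V)) (hE : ∀ e ∈ E, ¬ e.IsDiag) :
    ∃ σ : Sym2 V → ℤ, (∀ e, σ e = 1 ∨ σ e = -1) ∧ ∀ v, signedDegree σ E v ∈ Set.Icc (-1) 2 := by
  obtain ⟨σ, hσ, hmin⟩ := exists_minimalFor_of_wellFoundedLT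
    (fun σ : Sym2 V → ℤ => ∀ e, σ e = 1 ∨ σ e = -1)
    (fun σ => ∑ v, imbalance (signedDegree σ E v)) ⟨fun _ => 1, fun _ => Or.inl rfl⟩
  refine ⟨σ, hσ, fun v => ?_⟩
  by_contra hv
  have hv' : imbalance (signedDegree σ E v) ≠ 0 := by
    rw [Set.mem_Icc] at hv
    unfold imbalance
    omega
  obtain ⟨σ', hσ', hlt⟩ := exists_imbalance_lt hσ hE hv'
  exact absurd (hmin hσ' hlt.le) (not_le.mpr hlt)

lemma edgeColorCount_true_add_false {V : Type} [Fintype V] [DecidableEq V] (G : SimpleGraph V)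
    [DecidableRel G.Adj] (c : Sym2 V → Bool) (v : V) :
    edgeColorCount G c v true + edgeColorCount G c v false = G.degree v := by
  rw [← G.card_incidenceFinset_eq_degree,
    ← Finset.card_filter_add_card_filter_not (s := G.incidenceFinset v) (fun e => c e = true)]
  simp [edgeColorCount]

lemma signedDegree_edgeFinset {V : Type} [Fintype V] [DecidableEq V] (G : SimpleGraph V)
    [DecidableRel G.Adj] {σ : Sym2 V → ℤ} (hσ : ∀ e, σ e = 1 ∨ σ e = -1) (v : V) :
    signedDegree σ G.edgeFinset v =
      (edgeColorCount G (fun e => decide (σ e = 1)) v true : ℤ) -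
        edgeColorCount G (fun e => decide (σ e = 1)) v false := by
  rw [signedDegree, ← Finset.sum_filter, ← G.incidenceFinset_eq_filter]
  simp only [edgeColorCount, Finset.card_filter, Nat.cast_sum]
  rw [← Finset.sum_sub_distrib]
  refine Finset.sum_congr rfl fun e _ => ?_
  rcases hσ e with h | h <;> simp [h]

/-- Every finite simple graph has an edge 2-coloring with colors red
and blue such that every vertex `v` satisfies
`d_red(v) ∈ {⌊deg(v)/2⌋, ⌊deg(v)/2⌋ + 1}` and `d_blue(v) ∈ {⌈deg(v)/2⌉ - 1, ⌈deg(v)/2⌉}`. -/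
theorem balanced_edge_two_coloring {V : Type} [Fintype V] [DecidableEq V]
    (G : SimpleGraph V) [DecidableRel G.Adj] :
    ∃ c : Sym2 V → Bool,
      ∀ v : V,
        ((edgeColorCount G c v true : ℤ) = ⌊(G.degree v : ℚ) / 2⌋ ∨
          (edgeColorCount G c v true : ℤ) = ⌊(G.degree v : ℚ) / 2⌋ + 1) ∧
        ((edgeColorCount G c v false : ℤ) = ⌈(G.degree v : ℚ) / 2⌉ - 1 ∨
          (edgeColorCount G c v false : ℤ) = ⌈(G.degree v : ℚ) / 2⌉) := by
  obtain ⟨σ, hσ, hbal⟩ := exists_signs_signedDegree_mem_Icc G.edgeFinset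
    fun e he => G.not_isDiag_of_mem_edgeFinset he
  refine ⟨fun e => decide (σ e = 1), fun v => ?_⟩
  have hsum := edgeColorCount_true_add_false G (fun e => decide (σ e = 1)) v
  have hv := hbal v
  rw [signedDegree_edgeFinset G hσ, Set.mem_Icc] at hv
  have hfloor : ⌊(G.degree v : ℚ) / 2⌋ = (G.degree v : ℤ) / 2 := by
    simpa using Rat.floor_intCast_div_natCast (G.degree v) 2
  have hceil : ⌈(G.degree v : ℚ) / 2⌉ = -(-(G.degree v : ℤ) / 2) := by
    simpa using Rat.ceil_intCast_div_natCast (G.degree v) 2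
  rw [hfloor, hceil]
  omega
end

section
/- Let G be a finite simple graph in which every edge is assigned a type, either C or O. Then there exists a red-blue labeling of the darts of G that is consistent with the types and such that every vertex v of degree at least 3 satisfies d_red(v) ≥ 1 and d_blue(v) ≥ 1. -/
namespace DartLabeling

variable {V : Type}

/-- The color of the dart at `v` pointing to `w`, given an edge labeling `x` and an offset `o`. -/
def color (o : V → V → Bool) (x : Sym2 V → Bool) (v w : V) : Bool :=
  xor (x s(v, w)) (o v w)

/-- Change the label of the edge `e`. -/
def flip [DecidableEq V] (x : Sym2 V → Bool) (e : Sym2 V) : Sym2 V → Bool :=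
  Function.update x e (!x e)

theorem color_flip_self [DecidableEq V] {o : V → V → Bool} (x : Sym2 V → Bool) (v w : V) :
    color o (flip x s(v, w)) v w = !color o x v w := by
  simp [color, flip]

theorem color_flip_of_ne [DecidableEq V] {o : V → V → Bool} (x : Sym2 V → Bool) {v w : V}
    {e : Sym2 V} (h : s(v, w) ≠ e) :
    color o (flip x e) v w = color o x v w := by
  simp [color, flip, Function.update_of_ne h]

theorem flip_of_notMem [DecidableEq V] (x : Sym2 V → Bool) {e : Sym2 V} {v : V}
    (h : v ∉ e) (w : V) :
    flip x e s(v, w) = x s(v, w) := by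
  refine Function.update_of_ne ?_ _ _
  rintro rfl
  exact h (Sym2.mem_mk_left v w)

/-- Any typing of the edges is realized by an offset function on ordered pairs. -/
theorem exists_offset [Fintype V] (t : Sym2 V → EdgeType) :
    ∃ o : V → V → Bool, ∀ v w, v ≠ w →
      (t s(v, w) = EdgeType.C → o v w = o w v) ∧ (t s(v, w) = EdgeType.O → o v w ≠ o w v) := by
  classical
  let f := Fintype.equivFin V
  refine ⟨fun v w => decide (t s(v, w) = EdgeType.O ∧ f v < f w), fun v w hvw => ?_⟩
  have hf : f v ≠ f w := f.injective.ne hvw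
  beta_reduce
  rw [Sym2.eq_swap (a := w) (b := v)]
  refine ⟨fun h => by simp [h], fun h => ?_⟩
  rcases lt_or_gt_of_ne hf with h' | h' <;> simp [h, h', h'.le]

variable [Fintype V] (G : SimpleGraph V) [DecidableRel G.Adj]

/-- A vertex of degree at least `3` sees both colors. -/
def Good (o : V → V → Bool) (x : Sym2 V → Bool) (v : V) : Prop :=
  3 ≤ G.degree v → ∃ w w', G.Adj v w ∧ G.Adj v w' ∧ color o x v w ≠ color o x v w'

variable {G} {o : V → V → Bool}

theorem Good.congr {x x' : Sym2 V → Bool} {v : V} (hx : Good G o x v)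
    (h : ∀ w, x' s(v, w) = x s(v, w)) : Good G o x' v := by
  simpa only [Good, color, h] using hx

variable [DecidableEq V]

theorem exists_adj_ne_ne {v : V} (h : 3 ≤ G.degree v) (a b : V) :
    ∃ w, G.Adj v w ∧ w ≠ a ∧ w ≠ b := by
  have hcard : ({a, b} : Finset V).card < (G.neighborFinset v).card := by
    rw [G.card_neighborFinset_eq_degree]
    exact lt_of_le_of_lt Finset.card_le_two h
  obtain ⟨w, hw, hn⟩ := Finset.exists_mem_notMem_of_card_lt_card hcard
  simp only [Finset.mem_insert, Finset.mem_singleton, not_or] at hn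
  exact ⟨w, (G.mem_neighborFinset v w).1 hw, hn⟩

/-- A defect at a single vertex `v` can be pushed along a path until it disappears. Here `W` is the
set of vertices the path has already left and `p` is the predecessor of `v` on it. -/
theorem exists_good_of_good_except (B : Finset V) (W : Finset V) (x : Sym2 V → Bool) (v p : V)
    (hv : v ∉ W) (hB : ∀ u ∈ B, u ≠ v → Good G o x u)
    (hW : ∀ w ∈ W, ∀ y ∉ W, G.Adj w y → ¬(w = p ∧ y = v) → Good G o (flip x s(w, y)) w) :
    ∃ x', ∀ u ∈ B, Good G o x' u := by
  by_cases hgood : Good G o x v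
  · refine ⟨x, fun u hu => ?_⟩
    by_cases huv : u = v
    · exact huv ▸ hgood
    · exact hB u hu huv
  simp only [Good, not_forall, not_exists, not_and, not_not] at hgood
  obtain ⟨hdeg, hmono⟩ := hgood
  obtain ⟨u, hvu, hup, -⟩ := exists_adj_ne_ne hdeg p p
  have hv' : Good G o (flip x s(v, u)) v := by
    intro _
    obtain ⟨z, hvz, hzu, -⟩ := exists_adj_ne_ne hdeg u u
    refine ⟨u, z, hvu, hvz, ?_⟩
    rw [color_flip_self, color_flip_of_ne _ (mt Sym2.congr_right.1 hzu), hmono u z hvu hvz]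
    simp
  have hother : ∀ z ∈ B, z ≠ u → Good G o (flip x s(v, u)) z := by
    intro z hz hzu
    by_cases hzv : z = v
    · exact hzv ▸ hv'
    · exact (hB z hz hzv).congr (flip_of_notMem x (by simp [hzv, hzu]))
  by_cases huW : u ∈ W
  · refine ⟨flip x s(v, u), fun z hz => ?_⟩
    by_cases hzu : z = u
    · subst hzu
      rw [Sym2.eq_swap]
      exact hW z huW v hv hvu.symm fun h => hup h.1
    · exact hother z hz hzu
  · refine exists_good_of_good_except B (insert v W) (flip x s(v, u)) u v
      (by simp [hvu.ne', huW]) hother ?_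
    intro w hw y hy hwy hne
    simp only [Finset.mem_insert, not_or] at hw hy
    by_cases hwv : w = v
    · subst hwv
      have hyu : y ≠ u := fun h => hne ⟨rfl, h⟩
      intro _
      obtain ⟨z, hz, hzu, hzy⟩ := exists_adj_ne_ne hdeg u y
      refine ⟨y, z, hwy, hz, ?_⟩
      rw [color_flip_self, color_flip_of_ne _ (mt Sym2.congr_right.1 hyu),
        color_flip_of_ne _ (mt Sym2.congr_right.1 hzy), color_flip_of_ne _ (mt Sym2.congr_right.1 hzu),
        hmono y z hwy hz]
      simp
    · have hwW : w ∈ W := hw.resolve_left hwv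
      have hwu : w ≠ u := fun h => huW (h ▸ hwW)
      refine (hW w hwW y hy.2 hwy fun h => hy.1 h.2).congr fun z => ?_
      have hflip := flip_of_notMem x (e := s(v, u)) (v := w) (by simp [hwv, hwu])
      by_cases hzy : s(w, z) = s(w, y)
      · rw [hzy]
        simp only [flip, Function.update_self]
        exact congrArg _ (hflip y)
      · rw [flip, Function.update_of_ne hzy, flip, flip, Function.update_of_ne hzy]
        exact hflip z
termination_by Wᶜ.card
decreasing_by
  refine Finset.card_lt_card (Finset.compl_ssubset_compl.2 (Finset.ssubset_insert hv))

variable (G o) in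
theorem exists_forall_good : ∃ x, ∀ v, Good G o x v := by
  suffices h : ∀ B : Finset V, ∃ x, ∀ v ∈ B, Good G o x v by
    simpa using h Finset.univ
  intro B
  induction B using Finset.induction_on with
  | empty => exact ⟨fun _ => false, by simp⟩
  | insert v B _ ih =>
    obtain ⟨x, hx⟩ := ih
    refine exists_good_of_good_except (insert v B) ∅ x v v (by simp) ?_ (by simp)
    intro u hu huv
    exact hx u (Finset.mem_of_mem_insert_of_ne hu huv)

end DartLabeling

/-- For every finite simple graph whose edges are typed `C` or `O`,
there is a red-blue labeling of the darts, consistent with the types, such that every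
vertex of degree at least 3 has at least one red and at least one blue dart. -/
theorem dart_labeling_both_colors {V : Type} [Fintype V] [DecidableEq V]
    (G : SimpleGraph V) [DecidableRel G.Adj] (t : Sym2 V → EdgeType) :
    ∃ ℓ : G.Dart → Bool,
      (∀ d : G.Dart,
        (t d.edge = EdgeType.C → ℓ d = ℓ d.symm) ∧
        (t d.edge = EdgeType.O → ℓ d ≠ ℓ d.symm)) ∧
      (∀ v : V, 3 ≤ G.degree v →
        1 ≤ dartCount G ℓ v true ∧ 1 ≤ dartCount G ℓ v false) := by
  obtain ⟨o, ho⟩ := DartLabeling.exists_offset t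
  obtain ⟨x, hx⟩ := DartLabeling.exists_forall_good G o
  refine ⟨fun d => DartLabeling.color o x d.fst d.snd, fun d => ?_, fun v hv => ?_⟩
  · have h := ho d.fst d.snd d.adj.ne
    have hswap : DartLabeling.color o x d.symm.fst d.symm.snd = xor (x s(d.fst, d.snd)) (o d.snd d.fst) := by
      rw [Sym2.eq_swap]; rfl
    have hedge : d.edge = s(d.fst, d.snd) := rfl
    beta_reduce
    rw [hswap, hedge]
    simpa [DartLabeling.color] using h
  · have hcount : ∀ w, G.Adj v w →
        1 ≤ dartCount G (fun d => DartLabeling.color o x d.fst d.snd) v (DartLabeling.color o x v w) := by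
      intro w hw
      refine Finset.card_pos.2 ⟨⟨(v, w), hw⟩, ?_⟩
      simp
    obtain ⟨w, w', hw, hw', hne⟩ := hx v hv
    have h := hcount w hw
    have h' := hcount w' hw'
    cases hc : DartLabeling.color o x v w <;> cases hc' : DartLabeling.color o x v w' <;> simp_all
end

section
/- Let Δ ≥ 2 be an integer and let y ∈ {0, …, Δ−1}. Every finite simple graph G of maximum degree at most Δ has a set F of edges such that every vertex of degree exactly Δ is incident to exactly y or y+1 edges of F. In particular, every Δ-regular finite simple graph has a spanning subgraph in which every vertex has degree y or y+1. -/
namespace SimpleGraph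

variable {V : Type*} [Fintype V]

open Classical in
theorem degree_add_degree_of_eq_sdiff {H M K : SimpleGraph V} (hK : K = H \ M) (hM : M ≤ H)
    (v : V) : K.degree v + M.degree v = H.degree v := by
  simp only [← card_neighborFinset_eq_degree]
  rw [← Finset.card_union_of_disjoint]
  · congr 1
    ext w
    simp only [Finset.mem_union, mem_neighborFinset, hK, sdiff_adj]
    have := @hM v w
    tauto
  · rw [Finset.disjoint_left]
    intro w
    simp only [mem_neighborFinset, hK, sdiff_adj]
    tauto

open Classical in
/-- Deleting edges between vertices of degree `d + 1`, one at a time, makes the set of these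
vertices independent. -/
theorem exists_le_forall_adj_degree_le {d : ℕ} (W : Set V) (H : SimpleGraph V)
    (hmax : ∀ v, H.degree v ≤ d + 1) (hmin : ∀ v ∈ W, d ≤ H.degree v) :
    ∃ K ≤ H, (∀ v, K.degree v ≤ d + 1) ∧ (∀ v ∈ W, d ≤ K.degree v) ∧
      ∀ u v, K.Adj u v → K.degree u = d + 1 → K.degree v ≤ d := by
  induction H using WellFoundedLT.induction with
  | ind H ih =>
  by_cases h : ∀ u v, H.Adj u v → H.degree u = d + 1 → H.degree v ≤ d
  · exact ⟨H, le_rfl, hmax, hmin, h⟩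
  push Not at h
  obtain ⟨u, v, huv, hu, hv⟩ := h
  obtain ⟨M, hM⟩ : ∃ M, M = edge u v := ⟨_, rfl⟩
  have hle : M ≤ H := hM ▸ (edge_le_iff H).2 (Or.inr huv)
  have hlt : H \ M < H := by
    refine lt_of_le_of_ne sdiff_le fun h => ?_
    have : ¬ (H \ M).Adj u v := by simp [hM, edge_adj, huv.ne]
    exact this (h.symm ▸ huv)
  have hdeg := degree_add_degree_of_eq_sdiff rfl hle
  obtain ⟨K, hK, hK'⟩ := ih _ hlt (fun w => by have := hdeg w; have := hmax w; omega) <| by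
    intro w hw
    have hw' := hdeg w
    have hmin' := hmin w hw
    by_cases hwu : w = u ∨ w = v
    · have hone : M.degree w ≤ 1 := by
        rw [← card_neighborFinset_eq_degree, Finset.card_le_one]
        simp only [mem_neighborFinset, hM, edge_adj]
        grind
      rcases hwu with rfl | rfl <;> omega
    · have hzero : M.degree w = 0 := by
        rw [← card_neighborFinset_eq_degree, Finset.card_eq_zero]
        ext x
        simp only [mem_neighborFinset, hM, edge_adj]
        grind
      omega
  exact ⟨K, hK.trans hlt.le, hK'⟩

open Classical in
/-- If every neighbour of a vertex of degree `d + 1` has degree at most `d`, then some matching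
saturates the vertices of degree `d + 1`. -/
theorem exists_injective_adj_of_degree_le {d : ℕ} {H : SimpleGraph V}
    (h : ∀ u v, H.Adj u v → H.degree u = d + 1 → H.degree v ≤ d) :
    ∃ f : {v // H.degree v = d + 1} → V, Function.Injective f ∧ ∀ v, H.Adj v.1 (f v) := by
  have hall := (Finset.all_card_le_biUnion_card_iff_exists_injective
    (fun v : {v // H.degree v = d + 1} => H.neighborFinset v)).1 fun s => by
      have key := Finset.card_mul_le_card_mul (m := d + 1) (n := d) (s := s)
        (t := s.biUnion fun v => H.neighborFinset v) (fun v w => H.Adj v.1 w) ?_ ?_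
      · nlinarith
      · intro a ha
        refine a.2.symm.trans_le ?_
        rw [← card_neighborFinset_eq_degree]
        refine Finset.card_le_card fun w hw => ?_
        rw [Finset.mem_bipartiteAbove]
        exact ⟨Finset.mem_biUnion.2 ⟨a, ha, hw⟩, (mem_neighborFinset ..).1 hw⟩
      · intro b hb
        obtain ⟨a, -, hab⟩ := Finset.mem_biUnion.1 hb
        refine le_trans ?_ (h a b ((mem_neighborFinset ..).1 hab) a.2)
        rw [← card_neighborFinset_eq_degree]
        refine Finset.card_le_card_of_injOn Subtype.val (fun x hx => ?_)
          Subtype.val_injective.injOn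
        have hx' := (Finset.mem_bipartiteBelow _).1 (Finset.mem_coe.1 hx)
        simpa using hx'.2.symm
  simpa using hall

open Classical in
theorem exists_le_degree_bounds_pred {d : ℕ} (W : Set V) (H : SimpleGraph V)
    (hmax : ∀ v, H.degree v ≤ d + 2) (hmin : ∀ v ∈ W, d + 1 ≤ H.degree v) :
    ∃ K ≤ H, (∀ v, K.degree v ≤ d + 1) ∧ ∀ v ∈ W, d ≤ K.degree v := by
  obtain ⟨K, hK, hKmax, hKmin, hind⟩ := exists_le_forall_adj_degree_le W H hmax hmin
  obtain ⟨f, hf, hadj⟩ := exists_injective_adj_of_degree_le hind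
  have hfdeg v : K.degree (f v) ≤ d + 1 := hind v (f v) (hadj v) v.2
  obtain ⟨M, hMadj⟩ : ∃ M : SimpleGraph V, M = fromRel fun u v =>
    ∃ h : K.degree u = d + 1 + 1, f ⟨u, h⟩ = v := ⟨_, rfl⟩
  have hM : M ≤ K := by
    intro u v huv
    rw [hMadj] at huv
    rcases huv with ⟨-, ⟨h, rfl⟩ | ⟨h, rfl⟩⟩
    · exact hadj ⟨u, h⟩
    · exact (hadj ⟨v, h⟩).symm
  have hdeg := degree_add_degree_of_eq_sdiff rfl hM
  have hone : ∀ v, M.degree v ≤ 1 := by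
    intro v
    rw [← card_neighborFinset_eq_degree, Finset.card_le_one]
    intro a ha b hb
    rw [mem_neighborFinset, hMadj] at ha hb
    obtain ⟨-, ha⟩ := ha
    obtain ⟨-, hb⟩ := hb
    rcases ha with ⟨h, rfl⟩ | ⟨h, rfl⟩ <;> rcases hb with ⟨h', hb⟩ | ⟨h', hb⟩
    · exact hb
    · have := hfdeg ⟨b, h'⟩
      rw [hb] at this
      omega
    · have := hfdeg ⟨a, h⟩
      omega
    · exact congrArg Subtype.val (hf hb.symm)
  refine ⟨K \ M, sdiff_le.trans hK, fun v => ?_, fun v hv => ?_⟩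
  · have hv := hdeg v
    rcases (hKmax v).lt_or_eq with h | h
    · omega
    · have : 0 < M.degree v := (degree_pos_iff_exists_adj ..).2
        ⟨f ⟨v, h⟩, hMadj ▸ ⟨(hadj ⟨v, h⟩).ne, Or.inl ⟨h, rfl⟩⟩⟩
      omega
  · have := hdeg v
    have := hone v
    have := hKmin v hv
    omega

open Classical in
theorem exists_le_degree_bounds_of_le {d k : ℕ} (hk : k ≤ d) (W : Set V) (H : SimpleGraph V)
    (hmax : ∀ v, H.degree v ≤ d + 1) (hmin : ∀ v ∈ W, d ≤ H.degree v) :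
    ∃ K ≤ H, (∀ v, K.degree v ≤ k + 1) ∧ ∀ v ∈ W, k ≤ K.degree v := by
  induction hk using Nat.decreasingInduction with
  | self => exact ⟨H, le_rfl, hmax, hmin⟩
  | of_succ k _ ih =>
    obtain ⟨K, hK, hKmax, hKmin⟩ := ih
    obtain ⟨L, hL, hL'⟩ := exists_le_degree_bounds_pred W K hKmax hKmin
    exact ⟨L, hL.trans hK, hL'⟩

end SimpleGraph

/-- For `Δ ≥ 2` and `y ∈ {0, …, Δ-1}`, every finite simple graph of
maximum degree at most `Δ` has a set `F` of edges such that every vertex of degree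
exactly `Δ` is incident to exactly `y` or `y+1` edges of `F`.  In particular, every
`Δ`-regular finite simple graph has a spanning subgraph (given by an edge set `F`) in
which every vertex has degree `y` or `y+1`. -/
theorem exists_almost_factor {V : Type} [Fintype V] [DecidableEq V]
    (G : SimpleGraph V) [DecidableRel G.Adj]
    (Δ y : ℕ) (hΔ : 2 ≤ Δ) (hy : y ≤ Δ - 1)
    (hmax : ∀ v : V, G.degree v ≤ Δ) :
    (∃ F : Finset (Sym2 V), F ⊆ G.edgeFinset ∧
      ∀ v : V, G.degree v = Δ →
        ((F.filter (fun e => v ∈ e)).card = y ∨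
          (F.filter (fun e => v ∈ e)).card = y + 1)) ∧
    (G.IsRegularOfDegree Δ →
      ∃ F : Finset (Sym2 V), F ⊆ G.edgeFinset ∧
        ∀ v : V,
          ((F.filter (fun e => v ∈ e)).card = y ∨
            (F.filter (fun e => v ∈ e)).card = y + 1)) := by
  classical
  have key : ∃ F : Finset (Sym2 V), F ⊆ G.edgeFinset ∧ ∀ v : V, G.degree v = Δ →
      ((F.filter (fun e => v ∈ e)).card = y ∨ (F.filter (fun e => v ∈ e)).card = y + 1) := by
    obtain ⟨K, hK, hKmax, hKmin⟩ := SimpleGraph.exists_le_degree_bounds_of_le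
      (d := Δ) (k := y) (by omega) {v | G.degree v = Δ} G
      (fun v => Nat.le_succ_of_le (by convert hmax v))
      (fun v hv => Nat.le_of_eq (Eq.symm (by convert show G.degree v = Δ from hv)))
    refine ⟨K.edgeFinset, SimpleGraph.edgeFinset_mono hK, fun v hv => ?_⟩
    have hcard : (K.edgeFinset.filter (fun e => v ∈ e)).card = K.degree v := by
      rw [← SimpleGraph.incidenceFinset_eq_filter, SimpleGraph.card_incidenceFinset_eq_degree]
    have := hKmax v
    have := hKmin v hv
    omega
  refine ⟨key, fun hreg => ?_⟩
  obtain ⟨F, hF, hdeg⟩ := key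
  exact ⟨F, hF, fun v => hdeg v (hreg v)⟩
end

section
/- Let Δ ≥ 2 be an integer, let y ∈ {0, …, Δ−1}, and let G be a finite simple graph of maximum degree at most Δ. Then there exists an edge 2-coloring of G that solves Π(y). -/
/-- The quantity `x̃_d = (d/Δ)·(y + 1/2)` as a rational number. -/
def xTilde (Δ y d : ℤ) : ℚ := ((d : ℚ) / (Δ : ℚ)) * ((y : ℚ) + 1 / 2)

/-- An integer `x` is `(y,d)`-admissible (for the maximum degree `Δ`):
with `τ_d = d/(2Δ)`, `α_d = ⌊x̃_d⌋`, `β_d = x̃_d - α_d`, we require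
`x ∈ {α_d, α_d + 1}`, `x = α_d` whenever `β_d ≤ τ_d`, and `x = α_d + 1`
whenever `β_d ≥ 1 - τ_d`. -/
def Admissible (Δ y d x : ℤ) : Prop :=
  (x = ⌊xTilde Δ y d⌋ ∨ x = ⌊xTilde Δ y d⌋ + 1) ∧
  (xTilde Δ y d - (⌊xTilde Δ y d⌋ : ℚ) ≤ (d : ℚ) / (2 * (Δ : ℚ)) → x = ⌊xTilde Δ y d⌋) ∧
  (1 - (d : ℚ) / (2 * (Δ : ℚ)) ≤ xTilde Δ y d - (⌊xTilde Δ y d⌋ : ℚ) →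
    x = ⌊xTilde Δ y d⌋ + 1)

/-- The number of red edges (`c e = true`) incident to `v`. -/
def dRed {V : Type} [Fintype V] [DecidableEq V] (G : SimpleGraph V)
    [DecidableRel G.Adj] (c : Sym2 V → Bool) (v : V) : ℕ :=
  ((G.incidenceFinset v).filter (fun e => c e = true)).card

/-- An edge 2-coloring `c` (with `true` = red, `false` = blue) of a graph `G` of
maximum degree at most `Δ` solves `Π(y)` if (i) every vertex of degree `Δ` has
`d_red(v) ∈ {y, y+1}` and (ii) for every `d ∈ {1, …, Δ-1}` there exists a
`(y,d)`-admissible integer `x_d` such that every vertex of degree `d` has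
`d_red(v) ∈ {x_d - 1, x_d, x_d + 1}`. -/
def SolvesPi {V : Type} [Fintype V] [DecidableEq V] (Δ y : ℤ)
    (G : SimpleGraph V) [DecidableRel G.Adj] (c : Sym2 V → Bool) : Prop :=
  (∀ v : V, (G.degree v : ℤ) = Δ →
      ((dRed G c v : ℤ) = y ∨ (dRed G c v : ℤ) = y + 1)) ∧
  (∀ d : ℤ, 1 ≤ d → d ≤ Δ - 1 →
    ∃ x : ℤ, Admissible Δ y d x ∧
      ∀ v : V, (G.degree v : ℤ) = d →
        ((dRed G c v : ℤ) = x - 1 ∨ (dRed G c v : ℤ) = x ∨ (dRed G c v : ℤ) = x + 1))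

section AlternatingPath

variable {V : Type*} [DecidableEq V]

/-- `AltPath G c v₀ b z S`: there is a colour-alternating simple path in `G` from `v₀` to `z`
with vertex set `S`, whose first edge is red and whose continuation would have colour `b`. -/
inductive AltPath (G : SimpleGraph V) (c : Sym2 V → Bool) (v₀ : V) : Bool → V → Finset V → Prop
  | nil : AltPath G c v₀ true v₀ {v₀}
  | snoc {b : Bool} {z w : V} {S : Finset V} : AltPath G c v₀ b z S → G.Adj z w →
      c s(z, w) = b → w ∉ S → AltPath G c v₀ (!b) w (insert w S)

variable {G : SimpleGraph V}

theorem AltPath.end_mem {c : Sym2 V → Bool} {v₀ z : V} {b : Bool} {S : Finset V}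
    (h : AltPath G c v₀ b z S) : z ∈ S := by
  cases h <;> simp

/-- Initial segments of alternating paths. -/
theorem AltPath.exists_initial_segment {c : Sym2 V → Bool} {v₀ z : V} {b : Bool} {S : Finset V}
    (h : AltPath G c v₀ b z S) {w : V} (hw : w ∈ S) :
    ∃ b' S', AltPath G c v₀ b' w S' ∧ S' ⊆ S ∧ (w ≠ z → z ∉ S') := by
  induction h with
  | nil =>
    obtain rfl := Finset.mem_singleton.1 hw
    exact ⟨_, _, .nil, subset_rfl, fun h => absurd rfl h⟩
  | @snoc b z u S hp hadj hc hu ih =>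
    rcases Finset.mem_insert.1 hw with rfl | hw
    · exact ⟨_, _, hp.snoc hadj hc hu, subset_rfl, fun h => absurd rfl h⟩
    · obtain ⟨b', S', hp', hS, -⟩ := ih hw
      exact ⟨b', S', hp', hS.trans (Finset.subset_insert _ _), fun _ hu' => hu (hS hu')⟩

end AlternatingPath

section Factor

variable {V : Type*} (G : SimpleGraph V) [DecidableRel G.Adj]

/-- The indicator that `v w` is a red edge of `G`. -/
def redInd (c : Sym2 V → Bool) (v w : V) : ℤ :=
  if G.Adj v w ∧ c s(v, w) = true then 1 else 0

/-- The indicator that `v w` is an edge of `G`. -/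
def adjInd (v w : V) : ℤ := if G.Adj v w then 1 else 0

/-- The change of the red degree of an endpoint when an edge of colour `b` is recoloured. -/
def flipSign (b : Bool) : ℤ := if b then -1 else 1

theorem redInd_symm (c : Sym2 V → Bool) (v w : V) : redInd G c v w = redInd G c w v := by
  simp only [redInd, G.adj_comm v w, Sym2.eq_swap (a := v) (b := w)]

theorem adjInd_symm (v w : V) : adjInd G v w = adjInd G w v := by
  simp only [adjInd, G.adj_comm v w]

theorem redInd_nonneg (c : Sym2 V → Bool) (v w : V) : 0 ≤ redInd G c v w := by
  unfold redInd; split_ifs <;> simp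

theorem redInd_le_adjInd (c : Sym2 V → Bool) (v w : V) : redInd G c v w ≤ adjInd G v w := by
  unfold redInd adjInd; split_ifs <;> simp_all

variable [Fintype V]

/-- The red degree, as an integer sum over all potential neighbours. -/
def redDeg (c : Sym2 V → Bool) (v : V) : ℤ := ∑ w, redInd G c v w

theorem sum_adjInd (v : V) : ∑ w, adjInd G v w = G.degree v := by
  simp [adjInd, Finset.sum_boole, ← SimpleGraph.card_neighborFinset_eq_degree,
    SimpleGraph.neighborFinset_eq_filter]

theorem redDeg_not (c : Sym2 V → Bool) (v : V) :
    redDeg G (fun e => !c e) v = G.degree v - redDeg G c v := by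
  rw [← sum_adjInd, redDeg, redDeg, ← Finset.sum_sub_distrib]
  refine Finset.sum_congr rfl fun w _ => ?_
  unfold redInd adjInd
  by_cases h : G.Adj v w <;> cases hc : c s(v, w) <;> simp [h, hc]

/-- The total amount by which red degrees leave the intervals `[g v, f v]`. -/
def violation (g f : V → ℤ) (c : Sym2 V → Bool) : ℤ :=
  ∑ v, (max 0 (redDeg G c v - f v) + max 0 (g v - redDeg G c v))

theorem violation_not (g f : V → ℤ) (c : Sym2 V → Bool) :
    violation G (fun v => G.degree v - f v) (fun v => G.degree v - g v) (fun e => !c e) =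
      violation G g f c := by
  refine Finset.sum_congr rfl fun v _ => ?_
  rw [redDeg_not]
  dsimp only
  omega

variable [DecidableEq V]

/-- Recolouring a single edge changes the red degrees of exactly its two endpoints. -/
theorem redDeg_update (c : Sym2 V → Bool) {z w : V} (h : G.Adj z w) (v : V) :
    redDeg G (Function.update c s(z, w) (!c s(z, w))) v =
      redDeg G c v + (if v = z then flipSign (c s(z, w)) else 0) +
        (if v = w then flipSign (c s(z, w)) else 0) := by
  have hzw : z ≠ w := h.ne
  have key : ∀ u, redInd G (Function.update c s(z, w) (!c s(z, w))) v u =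
      redInd G c v u + (if u = w then (if v = z then flipSign (c s(z, w)) else 0) else 0) +
        (if u = z then (if v = w then flipSign (c s(z, w)) else 0) else 0) := by
    intro u
    by_cases hvu : s(v, u) = s(z, w)
    · have hadj : G.Adj v u := by rwa [← SimpleGraph.mem_edgeSet, hvu, SimpleGraph.mem_edgeSet]
      rcases Sym2.eq_iff.1 hvu with ⟨rfl, rfl⟩ | ⟨rfl, rfl⟩
      · cases hc : c s(v, u) <;> simp [redInd, hadj, flipSign, hzw, hc]
      · cases hc : c s(u, v) <;> simp [redInd, hadj, flipSign, hzw, hc, hvu]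
    · have h1 : ¬ (u = w ∧ v = z) := by rintro ⟨rfl, rfl⟩; exact hvu rfl
      have h2 : ¬ (u = z ∧ v = w) := by rintro ⟨rfl, rfl⟩; exact hvu Sym2.eq_swap
      rw [← ite_and, ← ite_and, if_neg h1, if_neg h2]
      simp [redInd, Function.update_of_ne hvu]
  simp only [redDeg, key, Finset.sum_add_distrib, Finset.sum_ite_eq', Finset.mem_univ, if_true]

variable {G}

/-- Recolouring all edges of an alternating path changes the red degrees of its ends only. -/
theorem AltPath.exists_flip {c : Sym2 V → Bool} {v₀ z : V} {b : Bool} {S : Finset V}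
    (h : AltPath G c v₀ b z S) :
    ∃ c' : Sym2 V → Bool, (∀ e, (∃ u ∈ e, u ∉ S) → c' e = c e) ∧
      ∀ v, redDeg G c' v = redDeg G c v - (if v = v₀ then 1 else 0) -
        (if v = z then flipSign b else 0) := by
  induction h with
  | nil => exact ⟨c, fun _ _ => rfl, fun v => by split_ifs <;> simp [flipSign]⟩
  | @snoc b z w S hp hadj hc hw ih =>
    obtain ⟨c', hc', hd⟩ := ih
    have hzw : c' s(z, w) = b := by rw [hc' _ ⟨w, by simp, hw⟩, hc]
    refine ⟨Function.update c' s(z, w) (!c' s(z, w)), ?_, fun v => ?_⟩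
    · rintro e ⟨u, hue, huS⟩
      have hne : e ≠ s(z, w) := by
        rintro rfl
        rcases Sym2.mem_iff.1 hue with rfl | rfl
        · exact huS (Finset.mem_insert_of_mem hp.end_mem)
        · exact huS (Finset.mem_insert_self _ _)
      rw [Function.update_of_ne hne]
      exact hc' e ⟨u, hue, fun h => huS (Finset.mem_insert_of_mem h)⟩
    · rw [redDeg_update G c' hadj, hd, hzw]
      have hzw' : z ≠ w := hadj.ne
      cases b <;> simp only [flipSign, Bool.not_true, Bool.not_false, if_true, Bool.false_eq_true,
        if_false] <;> split_ifs <;> omega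

variable (G)

/-- A vertex of too large red degree allows the violation to be decreased. -/
theorem exists_violation_lt (θ : ℚ) (hθ0 : 0 ≤ θ) (hθ1 : θ ≤ 1) (g f : V → ℤ)
    (hgf : ∀ v, g v < f v) (hg : ∀ v, (g v : ℚ) ≤ θ * G.degree v)
    (hf : ∀ v, θ * G.degree v ≤ (f v : ℚ)) (c : Sym2 V → Bool) (v₀ : V)
    (hv₀ : f v₀ < redDeg G c v₀) :
    ∃ c', violation G g f c' < violation G g f c := by
  classical
  by_contra! hmin
  have low : ∀ z S, AltPath G c v₀ false z S → redDeg G c z ≤ g z := by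
    intro z S hp
    by_contra! hz
    obtain ⟨c', -, hd⟩ := hp.exists_flip
    refine (hmin c').not_gt (Finset.sum_lt_sum (fun v _ => ?_) ⟨v₀, Finset.mem_univ _, ?_⟩)
    · have := hgf v
      rw [hd]
      simp only [flipSign]
      split_ifs <;> subst_vars <;> first | contradiction | omega
    · have := hgf v₀
      rw [hd]
      simp only [flipSign]
      split_ifs <;> subst_vars <;> first | contradiction | omega
  have high : ∀ z S, AltPath G c v₀ true z S → f z ≤ redDeg G c z := by
    intro z S hp
    by_contra! hz
    have hne : v₀ ≠ z := by rintro rfl; omega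
    obtain ⟨c', -, hd⟩ := hp.exists_flip
    refine (hmin c').not_gt (Finset.sum_lt_sum (fun v _ => ?_) ⟨v₀, Finset.mem_univ _, ?_⟩)
    · have := hgf v
      rw [hd]
      simp only [flipSign]
      split_ifs <;> subst_vars <;> first | contradiction | omega
    · have := hgf v₀
      rw [hd]
      simp only [flipSign]
      split_ifs <;> first | contradiction | omega
  have closed : ∀ b z w S, AltPath G c v₀ b z S → G.Adj z w → c s(z, w) = b →
      ∃ S', AltPath G c v₀ (!b) w S' := by
    intro b z w S hp hadj hc
    by_cases hw : w ∈ S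
    · obtain ⟨b', S', hp', -, hz⟩ := hp.exists_initial_segment hw
      by_cases hb : b' = b
      · subst hb
        have hp'' := hp'.snoc hadj.symm (by rw [Sym2.eq_swap, hc]) (hz hadj.ne')
        have := hgf z
        cases b'
        · have := low _ _ hp; have := high _ _ hp''; omega
        · have := high _ _ hp; have := low _ _ hp''; omega
      · have : b' = !b := by cases b <;> cases b' <;> simp_all
        exact ⟨S', this ▸ hp'⟩
    · exact ⟨_, hp.snoc hadj hc hw⟩
  let H : Finset V := Finset.univ.filter fun z => ∃ S, AltPath G c v₀ true z S
  let L : Finset V := Finset.univ.filter fun z => ∃ S, AltPath G c v₀ false z S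
  have memH : ∀ z, z ∈ H ↔ ∃ S, AltPath G c v₀ true z S := by simp [H]
  have memL : ∀ z, z ∈ L ↔ ∃ S, AltPath G c v₀ false z S := by simp [L]
  have hRH : ∑ v ∈ H, redDeg G c v = ∑ v ∈ H, ∑ w ∈ L, redInd G c v w := by
    refine Finset.sum_congr rfl fun v hv => (Finset.sum_subset (Finset.subset_univ _) ?_).symm
    intro w _ hw
    refine if_neg fun ⟨hadj, hc⟩ => hw ?_
    obtain ⟨S, hS⟩ := (memH v).1 hv
    exact (memL w).2 (closed _ _ _ _ hS hadj hc)
  have hBL : ∑ v ∈ L, (G.degree v - redDeg G c v) =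
      ∑ v ∈ L, ∑ w ∈ H, (adjInd G v w - redInd G c v w) := by
    refine Finset.sum_congr rfl fun v hv => ?_
    rw [← sum_adjInd, redDeg, ← Finset.sum_sub_distrib]
    refine (Finset.sum_subset (Finset.subset_univ _) ?_).symm
    intro w _ hw
    by_cases hadj : G.Adj v w
    · cases hc : c s(v, w)
      · obtain ⟨S, hS⟩ := (memL v).1 hv
        exact absurd ((memH w).2 (closed _ _ _ _ hS hadj hc)) hw
      · simp [adjInd, redInd, hadj, hc]
    · simp [adjInd, redInd, hadj]
  have hRL : ∑ v ∈ H, ∑ w ∈ L, redInd G c v w ≤ ∑ v ∈ L, redDeg G c v := by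
    rw [Finset.sum_comm]
    refine Finset.sum_le_sum fun v _ => ?_
    simp only [fun w => redInd_symm G c w v]
    exact Finset.sum_le_sum_of_subset_of_nonneg (Finset.subset_univ _)
      fun w _ _ => redInd_nonneg G c v w
  have hDH : ∑ v ∈ H, ∑ w ∈ L, adjInd G v w ≤ ∑ v ∈ H, (G.degree v : ℤ) := by
    refine Finset.sum_le_sum fun v _ => ?_
    rw [← sum_adjInd]
    exact Finset.sum_le_sum_of_subset_of_nonneg (Finset.subset_univ _)
      fun w _ _ => (redInd_nonneg G c v w).trans (redInd_le_adjInd G c v w)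
  have hcomm : ∑ v ∈ L, ∑ w ∈ H, (adjInd G v w - redInd G c v w) =
      ∑ v ∈ H, ∑ w ∈ L, adjInd G v w - ∑ v ∈ H, ∑ w ∈ L, redInd G c v w := by
    rw [Finset.sum_comm, ← Finset.sum_sub_distrib]
    refine Finset.sum_congr rfl fun v _ => ?_
    rw [← Finset.sum_sub_distrib]
    refine Finset.sum_congr rfl fun w _ => ?_
    rw [adjInd_symm, redInd_symm]
  have hH : θ * ((∑ v ∈ H, (G.degree v : ℤ) : ℤ) : ℚ) <
      ((∑ v ∈ H, redDeg G c v : ℤ) : ℚ) := by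
    push_cast
    rw [Finset.mul_sum]
    refine Finset.sum_lt_sum (fun v hv => (hf v).trans ?_) ⟨v₀, (memH _).2 ⟨_, .nil⟩, ?_⟩
    · obtain ⟨S, hS⟩ := (memH v).1 hv
      exact_mod_cast high _ _ hS
    · exact (hf v₀).trans_lt (by exact_mod_cast hv₀)
  have hL : ((∑ v ∈ L, redDeg G c v : ℤ) : ℚ) ≤
      θ * ((∑ v ∈ L, (G.degree v : ℤ) : ℤ) : ℚ) := by
    push_cast
    rw [Finset.mul_sum]
    refine Finset.sum_le_sum fun v hv => le_trans ?_ (hg v)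
    obtain ⟨S, hS⟩ := (memL v).1 hv
    exact_mod_cast low _ _ hS
  rw [Finset.sum_sub_distrib, hcomm] at hBL
  rw [hRH] at hH
  generalize ∑ v ∈ H, ∑ w ∈ L, redInd G c v w = R at *
  generalize ∑ v ∈ H, ∑ w ∈ L, adjInd G v w = A at *
  generalize ∑ v ∈ L, redDeg G c v = r at *
  generalize ∑ v ∈ L, (G.degree v : ℤ) = D at *
  generalize ∑ v ∈ H, (G.degree v : ℤ) = E at *
  have hBL' : (D : ℚ) = r + (A - R) := by exact_mod_cast (by omega : D = r + (A - R))
  have hRL' : (R : ℚ) ≤ r := by exact_mod_cast hRL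
  have hDH' : (A : ℚ) ≤ E := by exact_mod_cast hDH
  rw [hBL'] at hL
  nlinarith [mul_nonneg hθ0 (sub_nonneg.2 hDH'),
    mul_nonneg (sub_nonneg.2 hθ1) (sub_nonneg.2 hRL')]

/-- If `g v ≤ θ * deg v ≤ f v` and `g v < f v` for all `v`, then `G` has a `(g, f)`-factor. -/
theorem exists_factor (θ : ℚ) (hθ0 : 0 ≤ θ) (hθ1 : θ ≤ 1) (g f : V → ℤ)
    (hgf : ∀ v, g v < f v) (hg : ∀ v, (g v : ℚ) ≤ θ * G.degree v)
    (hf : ∀ v, θ * G.degree v ≤ (f v : ℚ)) :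
    ∃ c : Sym2 V → Bool, ∀ v, g v ≤ redDeg G c v ∧ redDeg G c v ≤ f v := by
  obtain ⟨c, hc⟩ := Finite.exists_min (violation G g f)
  refine ⟨c, fun v => ⟨?_, ?_⟩⟩
  · by_contra! hv
    obtain ⟨c', hc'⟩ := exists_violation_lt G (1 - θ) (by linarith) (by linarith)
      (fun v => G.degree v - f v) (fun v => G.degree v - g v)
      (fun v => by have := hgf v; omega)
      (fun v => by have := hf v; push_cast; linarith)
      (fun v => by have := hg v; push_cast; linarith)
      (fun e => !c e) v (by rw [redDeg_not]; omega)
    have h := violation_not G g f (fun e => !c' e)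
    simp only [Bool.not_not] at h
    rw [violation_not, h] at hc'
    exact (hc _).not_gt hc'
  · by_contra! hv
    obtain ⟨c', hc'⟩ := exists_violation_lt G θ hθ0 hθ1 g f hgf hg hf c v hv
    exact (hc c').not_gt hc'

end Factor

theorem dRed_eq_redDeg {V : Type} [Fintype V] [DecidableEq V] (G : SimpleGraph V)
    [DecidableRel G.Adj] (c : Sym2 V → Bool) (v : V) : (dRed G c v : ℤ) = redDeg G c v := by
  unfold redDeg redInd dRed
  rw [Finset.sum_boole]
  norm_cast
  symm
  refine Finset.card_bij (fun w _ => s(v, w)) ?_ ?_ ?_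
  · intro w hw
    simp_all [SimpleGraph.mem_incidenceFinset]
  · intro a _ b _ h
    exact Sym2.congr_right.1 h
  · intro e he
    rw [Finset.mem_filter, SimpleGraph.mem_incidenceFinset] at he
    obtain ⟨⟨he, hv⟩, hc⟩ := he
    obtain ⟨w, rfl⟩ := hv
    exact ⟨w, by simp_all, rfl⟩

theorem exists_admissible {Δ : ℤ} (hΔ : 0 < Δ) (y : ℤ) {d : ℤ} (hd : d < Δ) :
    ∃ x, Admissible Δ y d x := by
  have hΔ' : (0 : ℚ) < Δ := by exact_mod_cast hΔ
  have hτ : (d : ℚ) / (2 * Δ) < 1 / 2 := by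
    have : (d : ℚ) < Δ := by exact_mod_cast hd
    rw [div_lt_div_iff₀ (by positivity) (by norm_num)]
    linarith
  by_cases h : xTilde Δ y d - (⌊xTilde Δ y d⌋ : ℚ) ≤ (d : ℚ) / (2 * (Δ : ℚ))
  · exact ⟨_, .inl rfl, fun _ => rfl, fun h' => by linarith⟩
  · exact ⟨_, .inr rfl, fun h' => absurd h' h, fun _ => rfl⟩

/-- For every `Δ ≥ 2`, every `y ∈ {0, …, Δ-1}`, and every finite
simple graph `G` of maximum degree at most `Δ`, there exists an edge 2-coloring of
`G` solving `Π(y)`. -/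
theorem exists_coloring_solvesPi {V : Type} [Fintype V] [DecidableEq V]
    (G : SimpleGraph V) [DecidableRel G.Adj]
    (Δ y : ℤ) (hΔ : 2 ≤ Δ) (hy0 : 0 ≤ y) (hy1 : y ≤ Δ - 1)
    (hmax : ∀ v : V, (G.degree v : ℤ) ≤ Δ) :
    ∃ c : Sym2 V → Bool, SolvesPi Δ y G c := by
  have hΔ' : (0 : ℚ) < Δ := by exact_mod_cast (by omega : 0 < Δ)
  have hy0' : (0 : ℚ) ≤ y := by exact_mod_cast hy0
  have hy1' : (y : ℚ) ≤ Δ - 1 := by exact_mod_cast hy1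
  have hx : ∀ d : ℤ, xTilde Δ y d = ((y : ℚ) + 1 / 2) / Δ * d := fun d => by
    unfold xTilde; ring
  obtain ⟨c, hc⟩ := exists_factor G (((y : ℚ) + 1 / 2) / Δ) (by positivity)
    (by rw [div_le_one hΔ']; linarith)
    (fun v => ⌊xTilde Δ y (G.degree v)⌋) (fun v => ⌊xTilde Δ y (G.degree v)⌋ + 1)
    (fun v => by omega)
    (fun v => by simpa [hx] using Int.floor_le (xTilde Δ y (G.degree v)))
    (fun v => by simpa [hx] using (Int.lt_floor_add_one (xTilde Δ y (G.degree v))).le)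
  refine ⟨c, fun v hv => ?_, fun d _ hd => ?_⟩
  · have hfl : ⌊xTilde Δ y (G.degree v)⌋ = y := by
      rw [hv, Int.floor_eq_iff, xTilde, div_self hΔ'.ne']
      constructor <;> linarith
    have := hc v
    rw [hfl] at this
    rw [dRed_eq_redDeg]
    omega
  · obtain ⟨x, hadm⟩ := exists_admissible (by omega) y (by omega : d < Δ)
    refine ⟨x, hadm, fun v hv => ?_⟩
    have := hc v
    have hx := hadm.1
    rw [hv] at this
    rw [dRed_eq_redDeg]
    omega
end

section
/- Let Δ ≥ 2 be an integer, let y ∈ {0, …, Δ−1}, let G be a finite simple graph of maximum degree at most Δ, and let c be an edge 2-coloring of G. Then c solves Π(y) if and only if the edge 2-coloring obtained from c by exchanging the colors red and blue solves Π(Δ − 1 − y). -/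
theorem xTilde_swap {Δ : ℤ} (hΔ : Δ ≠ 0) (y d : ℤ) :
    xTilde Δ (Δ - 1 - y) d = d - xTilde Δ y d := by
  have h : (Δ : ℚ) ≠ 0 := by exact_mod_cast hΔ
  unfold xTilde
  push_cast
  field_simp
  ring

theorem Admissible.swap {Δ y d x : ℤ} (hd : 0 ≤ d) (hdΔ : d < Δ)
    (h : Admissible Δ y d x) : Admissible Δ (Δ - 1 - y) d (d - x) := by
  have hΔ : 0 < Δ := by omega
  have hτ0 : (0 : ℚ) ≤ (d : ℚ) / (2 * (Δ : ℚ)) := by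
    have : (0 : ℚ) ≤ d := by exact_mod_cast hd
    have : (0 : ℚ) < Δ := by exact_mod_cast hΔ
    positivity
  have hτ1 : (d : ℚ) / (2 * (Δ : ℚ)) < 1 := by
    have h1 : (0 : ℚ) < Δ := by exact_mod_cast hΔ
    have h2 : (d : ℚ) < Δ := by exact_mod_cast hdΔ
    rw [div_lt_one (by positivity)]
    linarith
  unfold Admissible at h ⊢
  rw [xTilde_swap hΔ.ne']
  generalize (d : ℚ) / (2 * (Δ : ℚ)) = τ at *
  generalize xTilde Δ y d = t at *
  obtain ⟨hx, hlow, hhigh⟩ := h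
  have hle := Int.floor_le t
  have hlt := Int.lt_floor_add_one t
  generalize ⌊t⌋ = a at *
  rcases hle.eq_or_lt with heq | hpos
  · have hf : ⌊(d : ℚ) - t⌋ = d - a := by
      rw [← heq, ← Int.cast_sub, Int.floor_intCast]
    have hxa : x = a := hlow (by linarith)
    rw [hf]
    push_cast
    exact ⟨Or.inl (by omega), fun _ => by omega, fun hc => absurd hc (by linarith)⟩
  · have hf : ⌊(d : ℚ) - t⌋ = d - a - 1 := by
      rw [Int.floor_eq_iff]
      push_cast
      constructor <;> linarith
    rw [hf]
    push_cast
    refine ⟨by omega, fun hc => ?_, fun hc => ?_⟩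
    · have := hhigh (by linarith)
      omega
    · have := hlow (by linarith)
      omega

theorem dRed_add_dRed_not {V : Type} [Fintype V] [DecidableEq V] (G : SimpleGraph V)
    [DecidableRel G.Adj] (c : Sym2 V → Bool) (v : V) :
    dRed G c v + dRed G (fun e => !(c e)) v = G.degree v := by
  rw [← G.card_incidenceFinset_eq_degree v,
    ← Finset.card_filter_add_card_filter_not (s := G.incidenceFinset v) (fun e => c e = true)]
  simp [dRed]

theorem SolvesPi.color_swap {V : Type} [Fintype V] [DecidableEq V] {G : SimpleGraph V}
    [DecidableRel G.Adj] {Δ y : ℤ} {c : Sym2 V → Bool} (h : SolvesPi Δ y G c) :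
    SolvesPi Δ (Δ - 1 - y) G (fun e => !(c e)) := by
  refine ⟨fun v hv => ?_, fun d hd1 hd2 => ?_⟩
  · have := h.1 v hv
    have := dRed_add_dRed_not G c v
    omega
  · obtain ⟨x, hx, hred⟩ := h.2 d hd1 hd2
    refine ⟨d - x, hx.swap (by omega) (by omega), fun v hv => ?_⟩
    have := hred v hv
    have := dRed_add_dRed_not G c v
    omega

/-- For `Δ ≥ 2`, `y ∈ {0, …, Δ-1}`, a finite simple graph `G` of
maximum degree at most `Δ`, and an edge 2-coloring `c` of `G`: `c` solves `Π(y)`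
iff the coloring obtained from `c` by exchanging red and blue solves `Π(Δ - 1 - y)`. -/
theorem solvesPi_color_swap {V : Type} [Fintype V] [DecidableEq V]
    (G : SimpleGraph V) [DecidableRel G.Adj]
    (Δ y : ℤ) (hΔ : 2 ≤ Δ) (hy0 : 0 ≤ y) (hy1 : y ≤ Δ - 1)
    (hmax : ∀ v : V, (G.degree v : ℤ) ≤ Δ)
    (c : Sym2 V → Bool) :
    SolvesPi Δ y G c ↔ SolvesPi Δ (Δ - 1 - y) G (fun e => !(c e)) := by
  refine ⟨SolvesPi.color_swap, fun h => ?_⟩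
  simpa using h.color_swap
end

section
/- Let Δ ≥ 2 and d be integers with 1 ≤ d ≤ Δ−1, and let y and x be integers. Then x is (y,d)-admissible if and only if d − x is (Δ − 1 − y, d)-admissible. -/
/-- For `0 ≤ τ_d`, the integers admissible for `(Δ, y, d)` are those at distance less than
`1 - τ_d` from `x̃_d`. -/
theorem admissible_iff_abs_sub_lt {Δ d : ℤ} (y x : ℤ) (hτ : 0 ≤ (d : ℚ) / (2 * (Δ : ℚ))) :
    Admissible Δ y d x ↔ |(x : ℚ) - xTilde Δ y d| < 1 - (d : ℚ) / (2 * (Δ : ℚ)) := by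
  unfold Admissible
  generalize xTilde Δ y d = z
  generalize (d : ℚ) / (2 * (Δ : ℚ)) = τ at *
  have h1 := Int.floor_le z
  have h2 := Int.lt_floor_add_one z
  generalize ⌊z⌋ = a at *
  rw [abs_lt]
  constructor
  · rintro ⟨rfl | rfl, h3, h4⟩
    · have : ¬ 1 - τ ≤ z - x := fun h => by have := h4 h; omega
      constructor <;> linarith
    · have : ¬ z - a ≤ τ := fun h => by have := h3 h; omega
      push_cast
      constructor <;> linarith
  · rintro ⟨h3, h4⟩
    have h5 : a - 1 < x := by
      have : (a : ℚ) - 1 < x := by linarith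
      exact_mod_cast this
    have h6 : x < a + 2 := by
      have : (x : ℚ) < a + 2 := by linarith
      exact_mod_cast this
    have hx : x = a ∨ x = a + 1 := by omega
    rcases hx with rfl | rfl
    · exact ⟨.inl rfl, fun _ => rfl, fun h => by linarith⟩
    · push_cast at h3 h4
      exact ⟨.inr rfl, fun h => by linarith, fun _ => rfl⟩

theorem xTilde_complement {Δ : ℤ} (y d : ℤ) (hΔ : Δ ≠ 0) :
    xTilde Δ (Δ - 1 - y) d = d - xTilde Δ y d := by
  have : (Δ : ℚ) ≠ 0 := by exact_mod_cast hΔ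
  unfold xTilde
  push_cast
  field_simp
  ring

/-- For `Δ ≥ 2`, `1 ≤ d ≤ Δ-1`, and integers `y, x`:
`x` is `(y,d)`-admissible iff `d - x` is `(Δ - 1 - y, d)`-admissible. -/
theorem admissible_complement (Δ d y x : ℤ) (hΔ : 2 ≤ Δ)
    (hd1 : 1 ≤ d) (hd2 : d ≤ Δ - 1) :
    Admissible Δ y d x ↔ Admissible Δ (Δ - 1 - y) d (d - x) := by
  have hτ : 0 ≤ (d : ℚ) / (2 * (Δ : ℚ)) := by
    have h1 : (0 : ℚ) ≤ d := by exact_mod_cast (by omega : 0 ≤ d)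
    have h2 : (0 : ℚ) ≤ Δ := by exact_mod_cast (by omega : 0 ≤ Δ)
    positivity
  rw [admissible_iff_abs_sub_lt _ _ hτ, admissible_iff_abs_sub_lt _ _ hτ,
    xTilde_complement y d (by omega), Int.cast_sub, sub_sub_sub_cancel_left, abs_sub_comm]
end

section
/- Let Δ ≥ 2 and d be integers with 1 ≤ d ≤ Δ−1, and let y be an integer with 0 ≤ y ≤ (Δ−2)/2. If an integer x' is (2y, d)-admissible, then ⌈x'/2⌉ is (y, d)-admissible. -/
/-- Admissibility says exactly that `x` is at distance less than `1 - τ_d` from `x̃_d`. -/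
theorem admissible_iff {Δ d : ℤ} (hd1 : 1 ≤ d) (hd2 : d ≤ Δ - 1) (y x : ℤ) :
    Admissible Δ y d x ↔
      xTilde Δ y d - (1 - (d : ℚ) / (2 * Δ)) < x ∧
        (x : ℚ) < xTilde Δ y d + (1 - (d : ℚ) / (2 * Δ)) := by
  unfold Admissible
  have hd : (1 : ℚ) ≤ d := by exact_mod_cast hd1
  have hΔ : (d : ℚ) ≤ Δ - 1 := by exact_mod_cast hd2
  have hτ0 : 0 < (d : ℚ) / (2 * Δ) := div_pos (by linarith) (by linarith)
  have hτ1 : (d : ℚ) / (2 * Δ) < 1 / 2 := by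
    rw [div_lt_div_iff₀ (by linarith) (by norm_num)]
    linarith
  generalize (d : ℚ) / (2 * Δ) = τ at *
  generalize xTilde Δ y d = u
  have hfl := Int.floor_le u
  have hlt := Int.lt_floor_add_one u
  constructor
  · rintro ⟨rfl | rfl, h1, h2⟩
    · refine ⟨?_, by linarith⟩
      by_contra! h
      have := h2 (by linarith)
      omega
    · push_cast
      refine ⟨by linarith, ?_⟩
      by_contra! h
      have := h1 (by linarith)
      omega
  · rintro ⟨h1, h2⟩
    have hlow : ⌊u⌋ < x + 1 := by
      have : (⌊u⌋ : ℚ) < x + 1 := by linarith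
      exact_mod_cast this
    have hupp : x < ⌊u⌋ + 2 := by
      have : (x : ℚ) < ⌊u⌋ + 2 := by linarith
      exact_mod_cast this
    obtain rfl | rfl : x = ⌊u⌋ ∨ x = ⌊u⌋ + 1 := by omega
    · exact ⟨Or.inl rfl, fun _ => rfl, fun h => by linarith⟩
    · push_cast at h2
      exact ⟨Or.inr rfl, fun h => by linarith, fun _ => rfl⟩

theorem xTilde_two_mul (Δ y d : ℤ) :
    xTilde Δ (2 * y) d = 2 * xTilde Δ y d - (d : ℚ) / (2 * Δ) := by
  rw [xTilde, xTilde, div_mul_eq_div_div_swap]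
  push_cast
  ring

/-- For `Δ ≥ 2`, `1 ≤ d ≤ Δ-1`, and an integer `y` with
`0 ≤ y ≤ (Δ-2)/2`: if `x'` is `(2y, d)`-admissible, then `⌈x'/2⌉` is
`(y, d)`-admissible. -/
theorem admissible_halving_even (Δ d y x' : ℤ) (hΔ : 2 ≤ Δ)
    (hd1 : 1 ≤ d) (hd2 : d ≤ Δ - 1)
    (hy0 : 0 ≤ y) (hy1 : (y : ℚ) ≤ ((Δ : ℚ) - 2) / 2)
    (hx' : Admissible Δ (2 * y) d x') :
    Admissible Δ y d ⌈(x' : ℚ) / 2⌉ := by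
  rw [admissible_iff hd1 hd2] at hx' ⊢
  rw [xTilde_two_mul] at hx'
  obtain ⟨hlow, hupp⟩ := hx'
  have hΔpos : (0 : ℚ) < 2 * Δ := by exact_mod_cast (by omega : 0 < 2 * Δ)
  have hτ : (d : ℚ) / (2 * Δ) < 1 / 2 := by
    have : (d : ℚ) ≤ Δ - 1 := by exact_mod_cast hd2
    rw [div_lt_div_iff₀ hΔpos (by norm_num)]
    linarith
  obtain ⟨k, rfl | rfl⟩ := Int.even_or_odd' x'
  · have hk : ⌈((2 * k : ℤ) : ℚ) / 2⌉ = k := by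
      rw [Int.ceil_eq_iff]
      push_cast
      constructor <;> linarith
    rw [hk]
    push_cast at hlow hupp
    constructor <;> linarith
  · have hk : ⌈((2 * k + 1 : ℤ) : ℚ) / 2⌉ = k + 1 := by
      rw [Int.ceil_eq_iff]
      push_cast
      constructor <;> linarith
    rw [hk]
    push_cast at hlow hupp ⊢
    constructor <;> linarith
end

section
/- Let Δ ≥ 2 and d be integers with 1 ≤ d ≤ Δ−1, and let y be an integer with 0 ≤ y ≤ (Δ−3)/2. If an integer x' is (2y+1, d)-admissible, then ⌊x'/2⌋ is (y, d)-admissible. -/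
/-- The point `x̃_d` for `2y + 1` is twice the one for `y`, shifted by `τ_d`. -/
theorem xTilde_two_mul_add_one (Δ y d : ℤ) :
    xTilde Δ (2 * y + 1) d = 2 * xTilde Δ y d + (d : ℚ) / (2 * (Δ : ℚ)) := by
  unfold xTilde
  rw [mul_comm (2 : ℚ) (Δ : ℚ), ← div_div]
  push_cast
  ring

/-- For `Δ ≥ 2`, `1 ≤ d ≤ Δ-1`, and an integer `y` with
`0 ≤ y ≤ (Δ-3)/2`: if `x'` is `(2y+1, d)`-admissible, then `⌊x'/2⌋` is
`(y, d)`-admissible. -/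
theorem admissible_halving_odd (Δ d y x' : ℤ) (hΔ : 2 ≤ Δ)
    (hd1 : 1 ≤ d) (hd2 : d ≤ Δ - 1)
    (hy0 : 0 ≤ y) (hy1 : (y : ℚ) ≤ ((Δ : ℚ) - 3) / 2)
    (hx' : Admissible Δ (2 * y + 1) d x') :
    Admissible Δ y d ⌊(x' : ℚ) / 2⌋ := by
  have hΔq : (0 : ℚ) < 2 * (Δ : ℚ) := by exact_mod_cast (by omega : (0 : ℤ) < 2 * Δ)
  have hτ0 : 0 < (d : ℚ) / (2 * (Δ : ℚ)) :=
    div_pos (by exact_mod_cast (by omega : (0 : ℤ) < d)) hΔq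
  have hτ1 : (d : ℚ) / (2 * (Δ : ℚ)) < 1 / 2 := by
    have hdΔ : (d : ℚ) < Δ := by exact_mod_cast (by omega : d < Δ)
    rw [div_lt_iff₀ hΔq]
    linarith
  have hfloor : ⌊(x' : ℚ) / 2⌋ = x' / 2 := by
    simpa using Rat.floor_intCast_div_natCast x' 2
  rw [hfloor]
  unfold Admissible at hx' ⊢
  rw [xTilde_two_mul_add_one] at hx'
  generalize (d : ℚ) / (2 * (Δ : ℚ)) = τ at *
  generalize xTilde Δ y d = X at *
  obtain ⟨hx, hlow, hhigh⟩ := hx'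
  have ha := Int.floor_le X
  have ha' := Int.lt_floor_add_one X
  have hm := Int.floor_le (2 * X + τ)
  have hm' := Int.lt_floor_add_one (2 * X + τ)
  generalize ⌊X⌋ = a at *
  generalize ⌊2 * X + τ⌋ = m at *
  have hma : 2 * a ≤ m := by
    have : ((2 * a : ℤ) : ℚ) < ((m + 1 : ℤ) : ℚ) := by push_cast; linarith
    have := Int.cast_lt.mp this
    omega
  have hma' : m ≤ 2 * a + 2 := by
    have : (m : ℚ) < ((2 * a + 3 : ℤ) : ℚ) := by push_cast; linarith
    have := Int.cast_lt.mp this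
    omega
  obtain rfl | rfl | rfl : m = 2 * a ∨ m = 2 * a + 1 ∨ m = 2 * a + 2 := by omega
  all_goals push_cast at hlow hhigh hm hm'
  · refine ⟨by omega, fun _ => by omega, fun _ => by linarith⟩
  · refine ⟨by omega, fun _ => ?_, fun _ => ?_⟩
    · have := hlow (by linarith)
      omega
    · have := hhigh (by linarith)
      omega
  · refine ⟨by omega, fun _ => by linarith, fun _ => by omega⟩
end

section
/- There exists a constant C > 0 such that for all reals ρ₁, ρ₂ ∈ [0, 1/2] with ρ₁ + ρ₂ ≥ 1/2 and every finite simple graph G of maximum degree Δ ≥ 2, there is an orientation of the edges of G in which every vertex v has outdegree at most ρ₁·deg(v) + C·√(Δ·ln Δ) or indegree at most ρ₂·deg(v) + C·√(Δ·ln Δ). -/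
/-- `o` is an orientation of the simple graph `G`: for every edge `{u,v}` exactly one
of the two directions (`o u v = true`, meaning oriented from `u` to `v`, or
`o v u = true`) is chosen. -/
def IsOrientation {V : Type} (G : SimpleGraph V) (o : V → V → Bool) : Prop :=
  ∀ u v : V, G.Adj u v → (o u v = true ↔ ¬ o v u = true)

/-- The outdegree of `v` under the orientation `o`: the number of neighbors `u` of `v`
with the edge `{v,u}` oriented from `v` to `u`. -/
def outDeg {V : Type} [Fintype V] [DecidableEq V] (G : SimpleGraph V)
    [DecidableRel G.Adj] (o : V → V → Bool) (v : V) : ℕ :=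
  ((G.neighborFinset v).filter (fun u => o v u = true)).card

/-- The indegree of `v` under the orientation `o`: the number of neighbors `u` of `v`
with the edge `{u,v}` oriented from `u` to `v`. -/
def inDeg {V : Type} [Fintype V] [DecidableEq V] (G : SimpleGraph V)
    [DecidableRel G.Adj] (o : V → V → Bool) (v : V) : ℕ :=
  ((G.neighborFinset v).filter (fun u => o u v = true)).card

/-- `e(C, V∖C)`: the number of edges of `G` with exactly one endpoint in `C`,
counted as the number of darts whose tail is in `C` and whose head is not. -/
def cutCard {V : Type} [Fintype V] [DecidableEq V] (G : SimpleGraph V)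
    [DecidableRel G.Adj] (C : Finset V) : ℕ :=
  (Finset.univ.filter (fun d : G.Dart => d.fst ∈ C ∧ d.snd ∉ C)).card

open Finset in
/-- A finite family of arcs, encoded as vectors `δ_x - δ_y`, can be signed so that all
coordinates of the sum lie in `{-1, 0, 1}`. -/
theorem exists_balanced_signs {ι V : Type} [DecidableEq ι] [DecidableEq V] (n : ℕ) :
    ∀ (s : Finset ι) (w : ι → V → ℤ), #s = n →
      (∀ i ∈ s, ∃ x y, w i = Pi.single x 1 - Pi.single y 1) →
      ∃ σ : ι → ℤ, (∀ i, σ i = 1 ∨ σ i = -1) ∧ ∀ v, |∑ i ∈ s, σ i * w i v| ≤ 1 := by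
  induction n with
  | zero =>
    intro s w hs _
    obtain rfl := card_eq_zero.mp hs
    exact ⟨fun _ => 1, by simp, by simp⟩
  | succ n ih =>
    intro s w hs hw
    by_cases hmerge : ∃ i ∈ s, ∃ j ∈ s, i ≠ j ∧ ∃ τ : ℤ, (τ = 1 ∨ τ = -1) ∧
        ∃ x y, w i + τ • w j = Pi.single x 1 - Pi.single y 1
    · obtain ⟨i, hi, j, hj, hij, τ, hτ, x, y, hxy⟩ := hmerge
      obtain ⟨σ, hσ, hsum⟩ := ih (s.erase j) (Function.update w i (w i + τ • w j))
        (by rw [card_erase_of_mem hj, hs]; rfl) (by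
          intro k hk
          by_cases hki : k = i
          · subst hki
            exact ⟨x, y, by simpa using hxy⟩
          · simpa [hki] using hw k (mem_of_mem_erase hk))
      refine ⟨Function.update σ j (σ i * τ), ?_, fun v => ?_⟩
      · intro k
        by_cases hkj : k = j
        · subst hkj
          rcases hσ i with h | h <;> rcases hτ with h' | h' <;> simp [h, h']
        · simpa [hkj] using hσ k
      · have hi' : i ∈ s.erase j := mem_erase.mpr ⟨hij, hi⟩
        have hrest : ∑ k ∈ (s.erase j).erase i, Function.update σ j (σ i * τ) k * w k v =
            ∑ k ∈ (s.erase j).erase i, σ k * Function.update w i (w i + τ • w j) k v := by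
          refine sum_congr rfl fun k hk => ?_
          have hki : k ≠ i := ne_of_mem_erase hk
          have hkj : k ≠ j := ne_of_mem_erase (mem_of_mem_erase hk)
          simp [hki, hkj]
        have heq : ∑ k ∈ s, Function.update σ j (σ i * τ) k * w k v =
            ∑ k ∈ s.erase j, σ k * Function.update w i (w i + τ • w j) k v := by
          rw [← add_sum_erase s _ hj, ← add_sum_erase _ _ hi', ← add_sum_erase _ _ hi', hrest]
          simp [hij]
          ring
        rw [heq]
        exact hsum v
    · refine ⟨fun _ => 1, by simp, fun v => ?_⟩
      have hdisj : ∀ i ∈ s, ∀ j ∈ s, w i v ≠ 0 → w j v ≠ 0 → i = j := by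
        intro i hi j hj hiv hjv
        by_contra hij
        apply hmerge
        obtain ⟨a, b, hab⟩ := hw i hi
        obtain ⟨c, d, hcd⟩ := hw j hj
        refine ⟨i, hi, j, hj, hij, ?_⟩
        have hv : v = a ∨ v = b := by
          by_contra! h
          simp [hab, h.1, h.2] at hiv
        have hv' : v = c ∨ v = d := by
          by_contra! h
          simp [hcd, h.1, h.2] at hjv
        rw [hab, hcd]
        rcases hv with rfl | rfl <;> rcases hv' with rfl | rfl
        · exact ⟨-1, by simp, d, b, by simp⟩
        · exact ⟨1, by simp, c, b, by simp⟩
        · exact ⟨1, by simp, a, d, by simp⟩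
        · exact ⟨-1, by simp, a, c, by simp⟩
      by_cases hz : ∃ i ∈ s, w i v ≠ 0
      · obtain ⟨i, hi, hiv⟩ := hz
        rw [sum_eq_single_of_mem i hi fun j hj hji => by
          by_contra h
          exact hji (hdisj j hj i hi (by simpa using h) hiv)]
        obtain ⟨a, b, hab⟩ := hw i hi
        simp only [hab, Pi.sub_apply, Pi.single_apply]
        split_ifs <;> simp
      · push Not at hz
        rw [sum_eq_zero fun i hi => by simp [hz i hi]]
        simp

theorem IsOrientation.outDeg_add_inDeg {V : Type} [Fintype V] [DecidableEq V]
    {G : SimpleGraph V} [DecidableRel G.Adj] {o : V → V → Bool} (ho : IsOrientation G o)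
    (v : V) : outDeg G o v + inDeg G o v = G.degree v := by
  have h : inDeg G o v = ((G.neighborFinset v).filter fun u => ¬ o v u = true).card := by
    unfold inDeg
    congr 1
    refine Finset.filter_congr fun u hu => ?_
    exact ho u v ((G.mem_neighborFinset v u).mp hu).symm
  rw [h, outDeg, Finset.card_filter_add_card_filter_not, G.card_neighborFinset_eq_degree]

open Finset in
theorem exists_balanced_orientation {V : Type} [Fintype V] [DecidableEq V]
    (G : SimpleGraph V) [DecidableRel G.Adj] :
    ∃ o : V → V → Bool, IsOrientation G o ∧
      ∀ v, |(outDeg G o v : ℤ) - inDeg G o v| ≤ 1 := by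
  classical
  let : LinearOrder V := linearOrderOfSTO WellOrderingRel
  obtain ⟨σ, hσ, hsum⟩ := exists_balanced_signs _
    (univ.filter fun e : V × V => e.1 < e.2 ∧ G.Adj e.1 e.2)
    (fun e => Pi.single e.1 1 - Pi.single e.2 1) rfl (fun e _ => ⟨e.1, e.2, rfl⟩)
  let τ : V → V → ℤ := fun u v => if u < v then σ (u, v) else -σ (v, u)
  have hτ : ∀ u v, τ u v = 1 ∨ τ u v = -1 := by
    intro u v
    dsimp only [τ]
    split_ifs
    · exact hσ _
    · rcases hσ (v, u) with h | h <;> simp [h]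
  have hanti : ∀ u v, u ≠ v → τ v u = -τ u v := by
    intro u v huv
    dsimp only [τ]
    rcases lt_or_gt_of_ne huv with h | h <;> simp [h, h.not_gt]
  have ho : IsOrientation G fun u v => decide (τ u v = 1) := by
    intro u v huv
    have := hτ u v
    have := hanti u v huv.ne
    simp only [decide_eq_true_eq]
    lia
  refine ⟨_, ho, fun v => ?_⟩
  have hexcess : (outDeg G (fun u v => decide (τ u v = 1)) v : ℤ) -
      inDeg G (fun u v => decide (τ u v = 1)) v = ∑ u ∈ G.neighborFinset v, τ v u := by
    simp only [outDeg, inDeg, card_filter, Nat.cast_sum, ← sum_sub_distrib]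
    refine sum_congr rfl fun u hu => ?_
    have := hanti v u ((G.mem_neighborFinset v u).mp hu).ne
    rcases hτ v u with h | h <;> simp_all
  have hτsum : ∑ e ∈ univ.filter (fun e : V × V => e.1 < e.2 ∧ G.Adj e.1 e.2),
      σ e * (Pi.single e.1 1 - Pi.single e.2 1 : V → ℤ) v =
      ∑ u ∈ G.neighborFinset v, τ v u := by
    rw [sum_filter, Fintype.sum_prod_type, G.neighborFinset_eq_filter, sum_filter]
    have hterm : ∀ a b, (if a < b ∧ G.Adj a b then
          σ (a, b) * (Pi.single a 1 - Pi.single b 1 : V → ℤ) v else 0) =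
        (if v = a then if a < b ∧ G.Adj a b then σ (a, b) else 0 else 0) -
        (if v = b then if a < b ∧ G.Adj a b then σ (a, b) else 0 else 0) := by
      intro a b
      simp only [Pi.sub_apply, Pi.single_apply]
      split_ifs <;> simp
    simp only [hterm, sum_sub_distrib]
    rw [sum_comm]
    simp only [sum_ite_eq, mem_univ, if_true]
    rw [← sum_sub_distrib]
    refine sum_congr rfl fun u _ => ?_
    dsimp only [τ]
    by_cases huv : G.Adj v u
    · rcases lt_or_gt_of_ne huv.ne with h | h <;> simp [huv, huv.symm, h, h.not_gt]
    · simp [huv, G.adj_comm u v]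
  rw [hexcess, ← hτsum]
  exact hsum v

open Matrix in
theorem exists_signs_mul_adjMatrix_le {V : Type} [Fintype V] [DecidableEq V]
    (G : SimpleGraph V) [DecidableRel G.Adj] (w : V → ℝ) :
    ∃ c : V → Bool, ∀ v,
      (if c v then 1 else -1) *
        ((∑ u ∈ G.neighborFinset v, if c u then (1 : ℝ) else -1) - w v) ≤ 0 := by
  let sgn : (V → Bool) → V → ℝ := fun c u => if c u then 1 else -1
  let Φ : (V → Bool) → ℝ := fun c =>
    sgn c ⬝ᵥ (G.adjMatrix ℝ *ᵥ sgn c) - 2 * (w ⬝ᵥ sgn c)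
  obtain ⟨c, hc⟩ := Finite.exists_min Φ
  refine ⟨c, fun v => ?_⟩
  have hflip : sgn (Function.update c v (!c v)) = sgn c + Pi.single v (-2 * sgn c v) := by
    ext u
    by_cases huv : u = v
    · subst huv
      cases h : c u <;> simp [sgn, h] <;> norm_num
    · simp [sgn, huv]
  have hsymm : sgn c ⬝ᵥ (G.adjMatrix ℝ *ᵥ Pi.single v (-2 * sgn c v)) =
      -2 * sgn c v * ∑ u ∈ G.neighborFinset v, sgn c u := by
    rw [dotProduct_mulVec, dotProduct_single, G.adjMatrix_vecMul_apply, mul_comm]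
  have hmin := hc (Function.update c v (!c v))
  simp only [Φ, hflip, mulVec_add, add_dotProduct, dotProduct_add, hsymm, single_dotProduct,
    dotProduct_single, G.adjMatrix_mulVec_apply] at hmin
  have hdiag : ∑ u ∈ G.neighborFinset v, (Pi.single v (-2 * sgn c v) : V → ℝ) u = 0 :=
    Finset.sum_eq_zero fun u hu =>
      Pi.single_eq_of_ne ((G.mem_neighborFinset v u).mp hu).ne' _
  rw [hdiag] at hmin
  change sgn c v * ((∑ u ∈ G.neighborFinset v, sgn c u) - w v) ≤ 0
  linarith

open Finset in
/-- The vertices can be split into two classes so that each vertex has at most the fraction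
`p`, respectively `1 - p`, of its neighbors in its own class. -/
theorem exists_partition_card_le {V : Type} [Fintype V] [DecidableEq V]
    (G : SimpleGraph V) [DecidableRel G.Adj] (p : ℝ) :
    ∃ c : V → Bool, ∀ v,
      (#{u ∈ G.neighborFinset v | c v = c u} : ℝ) ≤
        (if c v then p else 1 - p) * G.degree v := by
  obtain ⟨c, hc⟩ := exists_signs_mul_adjMatrix_le G fun v => (2 * p - 1) * G.degree v
  refine ⟨c, fun v => ?_⟩
  have hsum : (if c v then 1 else -1) *
      (∑ u ∈ G.neighborFinset v, if c u then (1 : ℝ) else -1) =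
      2 * #{u ∈ G.neighborFinset v | c v = c u} - G.degree v := by
    rw [← G.card_neighborFinset_eq_degree, card_filter, card_eq_sum_ones, mul_sum]
    push_cast
    rw [mul_sum, ← sum_sub_distrib]
    refine sum_congr rfl fun u _ => ?_
    cases c v <;> cases c u <;> norm_num
  have h := hc v
  rw [mul_sub, hsum] at h
  split_ifs at h ⊢ <;> linarith

/-- There is a constant `C > 0` such that for all
`ρ₁, ρ₂ ∈ [0, 1/2]` with `ρ₁ + ρ₂ ≥ 1/2` and every finite simple graph of maximum
degree `Δ ≥ 2`, there is an orientation of the edges in which every vertex `v` has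
outdegree at most `ρ₁·deg(v) + C·√(Δ·ln Δ)` or indegree at most
`ρ₂·deg(v) + C·√(Δ·ln Δ)`. -/
theorem exists_unbalanced_orientation :
    ∃ C : ℝ, 0 < C ∧
      ∀ (ρ₁ ρ₂ : ℝ), ρ₁ ∈ Set.Icc (0 : ℝ) (1 / 2) → ρ₂ ∈ Set.Icc (0 : ℝ) (1 / 2) →
        1 / 2 ≤ ρ₁ + ρ₂ →
      ∀ (V : Type) [Fintype V] [DecidableEq V]
        (G : SimpleGraph V) [DecidableRel G.Adj] (Δ : ℕ),
        2 ≤ Δ → G.maxDegree = Δ →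
        ∃ o : V → V → Bool, IsOrientation G o ∧
          ∀ v : V,
            (outDeg G o v : ℝ) ≤ ρ₁ * (G.degree v : ℝ) +
                C * Real.sqrt ((Δ : ℝ) * Real.log (Δ : ℝ)) ∨
            (inDeg G o v : ℝ) ≤ ρ₂ * (G.degree v : ℝ) +
                C * Real.sqrt ((Δ : ℝ) * Real.log (Δ : ℝ)) := by
  refine ⟨1, one_pos, ?_⟩
  intro ρ₁ ρ₂ _ _ hρ V _ _ G _ Δ hΔ _
  obtain ⟨c, hc⟩ := exists_partition_card_le G (2 * ρ₁)
  let H : SimpleGraph V :=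
    { Adj := fun u v => G.Adj u v ∧ c u = c v
      symm := ⟨fun _ _ h => ⟨h.1.symm, h.2.symm⟩⟩
      loopless := ⟨fun _ h => h.1.ne rfl⟩ }
  have : DecidableRel H.Adj := fun u v => inferInstanceAs (Decidable (G.Adj u v ∧ c u = c v))
  obtain ⟨o, ho, hbal⟩ := exists_balanced_orientation H
  have hdeg : ∀ v, H.degree v = ((G.neighborFinset v).filter fun u => c v = c u).card := by
    intro v
    rw [← H.card_neighborFinset_eq_degree]
    congr 1
    ext u
    simp [H]
  have herr : 1 ≤ Real.sqrt ((Δ : ℝ) * Real.log Δ) := by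
    rw [Real.one_le_sqrt]
    have hΔ' : (2 : ℝ) ≤ Δ := by exact_mod_cast hΔ
    have hlog : Real.log 2 ≤ Real.log Δ := Real.log_le_log two_pos hΔ'
    nlinarith [Real.log_two_gt_d9]
  refine ⟨fun u v => if c u = c v then o u v else c v, fun u v huv => ?_, fun v => ?_⟩
  · by_cases h : c u = c v
    · simpa [h] using ho u v ⟨huv, h⟩
    · have h' : ¬ c v = c u := fun e => h e.symm
      simp only [h, h', if_false]
      cases hu : c u <;> cases hv : c v <;> simp_all
  · have hsum := ho.outDeg_add_inDeg v
    have hb := abs_le.mp (hbal v)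
    have hd := hc v
    rw [← hdeg] at hd
    have hd0 : (0 : ℝ) ≤ G.degree v := Nat.cast_nonneg _
    cases hv : c v
    · right
      have hin : inDeg G (fun u v => if c u = c v then o u v else c v) v = inDeg H o v := by
        unfold inDeg
        congr 1
        ext u
        cases h : c u <;> simp [H, h, hv]
      have h2 : 2 * (inDeg H o v : ℝ) ≤ H.degree v + 1 := by
        exact_mod_cast (by lia : 2 * inDeg H o v ≤ H.degree v + 1)
      simp only [hv, Bool.false_eq_true, if_false] at hd
      rw [hin]
      nlinarith
    · left
      have hout : outDeg G (fun u v => if c u = c v then o u v else c v) v = outDeg H o v := by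
        unfold outDeg
        congr 1
        ext u
        cases h : c u <;> simp [H, h, hv]
      have h2 : 2 * (outDeg H o v : ℝ) ≤ H.degree v + 1 := by
        exact_mod_cast (by lia : 2 * outDeg H o v ≤ H.degree v + 1)
      simp only [hv, if_true] at hd
      rw [hout]
      linarith
end

section
/- For every γ > 0 there exists c > 0 such that the following holds. Let Δ ≥ 1 and n ≥ 1 be integers, let G be a Δ-regular simple graph on n vertices with vertex set V such that e(C, V∖C) ≤ (|C|·(n−|C|)/n)·(Δ + 3√Δ) + γ·√n for every C ⊆ V, and let ρ₁, ρ₂ ≥ 0 be reals with ρ₁ + ρ₂ = 1/2. Then there is no orientation of the edges of G in which every vertex has outdegree at most ρ₁·Δ − c·√Δ or indegree at most ρ₂·Δ − c·√Δ. -/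
theorem IsOrientation.flip {V : Type} {G : SimpleGraph V} {o : V → V → Bool}
    (ho : IsOrientation G o) : IsOrientation G (fun u v => o v u) :=
  fun u v huv => ho v u huv.symm

section Cut

variable {V : Type} [Fintype V] [DecidableEq V] (G : SimpleGraph V) [DecidableRel G.Adj]

theorem cutCard_eq_sum (C : Finset V) :
    cutCard G C = ∑ u ∈ C, ((G.neighborFinset u).filter (fun v => v ∉ C)).card := by
  rw [← Finset.card_sigma]
  refine Finset.card_bij (fun d _ => ⟨d.fst, d.snd⟩) ?_ ?_ ?_
  · intro d hd
    simpa [d.adj] using hd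
  · intro d _ d' _ h
    ext <;> simp_all
  · rintro ⟨u, v⟩ h
    simp only [Finset.mem_sigma, Finset.mem_filter, SimpleGraph.mem_neighborFinset] at h
    exact ⟨⟨(u, v), h.2.1⟩, by simpa using ⟨h.1, h.2.2⟩, rfl⟩

theorem cutCard_compl (C : Finset V) : cutCard G Cᶜ = cutCard G C := by
  refine Finset.card_bij (fun d _ => d.symm) ?_ ?_ ?_
  · intro d hd
    simp_all
  · intro d _ d' _ h
    exact SimpleGraph.Dart.symm_involutive.injective h
  · intro d hd
    exact ⟨d.symm, by simp_all, d.symm_symm⟩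

variable {G} {Δ : ℕ}

theorem cutCard_le_mul_card (hG : G.IsRegularOfDegree Δ) (C : Finset V) :
    cutCard G C ≤ C.card * Δ := by
  rw [cutCard_eq_sum, ← smul_eq_mul]
  refine Finset.sum_le_card_nsmul _ _ _ fun u _ => ?_
  exact (Finset.card_filter_le _ _).trans (hG u).le

/-- The vertices of `C` send out at least as many edges as `C` spans. -/
theorem mul_card_le_two_mul_sum_outDeg_add_cutCard (hG : G.IsRegularOfDegree Δ)
    {o : V → V → Bool} (ho : IsOrientation G o) (C : Finset V) :
    C.card * Δ ≤ 2 * ∑ u ∈ C, outDeg G o u + cutCard G C := by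
  let f : V → V → ℕ := fun u v => if G.Adj u v ∧ o u v = true then 1 else 0
  have hout : ∀ u, ∑ v ∈ C, f u v ≤ outDeg G o u := by
    intro u
    rw [← Finset.card_filter]
    refine Finset.card_le_card fun v hv => ?_
    simp_all
  have hf : ∀ u v, f u v + f v u = if G.Adj u v then 1 else 0 := by
    intro u v
    by_cases h : G.Adj u v
    · have h1 := ho u v h
      by_cases h2 : o v u = true <;> simp_all [f, h.symm]
    · have h' : ¬ G.Adj v u := fun h' => h h'.symm
      simp [f, h, h']
  have hspan : 2 * ∑ u ∈ C, ∑ v ∈ C, f u v =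
      ∑ u ∈ C, ((G.neighborFinset u).filter (fun v => v ∈ C)).card := by
    have hcomm : ∑ u ∈ C, ∑ v ∈ C, f u v = ∑ u ∈ C, ∑ v ∈ C, f v u := Finset.sum_comm
    rw [two_mul]
    nth_rewrite 2 [hcomm]
    simp only [← Finset.sum_add_distrib, hf]
    refine Finset.sum_congr rfl fun u _ => ?_
    rw [← Finset.card_filter]
    congr 1
    ext v
    simp [and_comm]
  have hdeg : C.card * Δ =
      ∑ u ∈ C, ((G.neighborFinset u).filter (fun v => v ∈ C)).card + cutCard G C := by
    rw [cutCard_eq_sum, ← Finset.sum_add_distrib, ← smul_eq_mul, ← Finset.sum_const]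
    refine Finset.sum_congr rfl fun u _ => ?_
    rw [Finset.card_filter_add_card_filter_not]
    exact (hG u).symm
  have := Finset.sum_le_sum fun u (_ : u ∈ C) => hout u
  omega

/-- If every vertex of `C` has small outdegree, then many edges leave `C`. -/
theorem le_cutCard_of_outDeg_le (hG : G.IsRegularOfDegree Δ)
    {o : V → V → Bool} (ho : IsOrientation G o) (C : Finset V) {r : ℝ}
    (hC : ∀ u ∈ C, (outDeg G o u : ℝ) ≤ r) :
    C.card * (Δ - 2 * r) ≤ cutCard G C := by
  have h : (C.card : ℝ) * Δ ≤ 2 * ∑ u ∈ C, (outDeg G o u : ℝ) + cutCard G C := by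
    exact_mod_cast mul_card_le_two_mul_sum_outDeg_add_cutCard hG ho C
  have hsum := Finset.sum_le_card_nsmul C _ r hC
  rw [nsmul_eq_mul] at hsum
  linarith

end Cut

/-- For every `γ > 0` there is `c > 0` such that: for all integers
`Δ ≥ 1` and `n ≥ 1`, every `Δ`-regular simple graph `G` on `n` vertices satisfying
`e(C, V∖C) ≤ (|C|·(n-|C|)/n)·(Δ + 3√Δ) + γ·√n` for every vertex subset `C`, and all
reals `ρ₁, ρ₂ ≥ 0` with `ρ₁ + ρ₂ = 1/2`, there is no orientation of the edges of `G`
in which every vertex has outdegree at most `ρ₁·Δ - c·√Δ` or indegree at most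
`ρ₂·Δ - c·√Δ`. -/
theorem no_unbalanced_orientation (γ : ℝ) (hγ : 0 < γ) :
    ∃ c : ℝ, 0 < c ∧
      ∀ (Δ n : ℕ), 1 ≤ Δ → 1 ≤ n →
      ∀ (V : Type) [Fintype V] [DecidableEq V]
        (G : SimpleGraph V) [DecidableRel G.Adj],
        Fintype.card V = n → G.IsRegularOfDegree Δ →
        (∀ C : Finset V,
          (cutCard G C : ℝ) ≤
            ((C.card : ℝ) * ((n : ℝ) - (C.card : ℝ)) / (n : ℝ)) *
              ((Δ : ℝ) + 3 * Real.sqrt (Δ : ℝ)) + γ * Real.sqrt (n : ℝ)) →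
        ∀ (ρ₁ ρ₂ : ℝ), 0 ≤ ρ₁ → 0 ≤ ρ₂ → ρ₁ + ρ₂ = 1 / 2 →
        ¬ ∃ o : V → V → Bool, IsOrientation G o ∧
            ∀ v : V,
              (outDeg G o v : ℝ) ≤ ρ₁ * (Δ : ℝ) - c * Real.sqrt (Δ : ℝ) ∨
              (inDeg G o v : ℝ) ≤ ρ₂ * (Δ : ℝ) - c * Real.sqrt (Δ : ℝ) := by
  refine ⟨1 + γ, by linarith, ?_⟩
  rintro Δ n hΔ hn V _ _ G _ hV hG hcut ρ₁ ρ₂ hρ₁ hρ₂ hρ ⟨o, ho, hdeg⟩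
  let A : Finset V := Finset.univ.filter fun v =>
    (outDeg G o v : ℝ) ≤ ρ₁ * (Δ : ℝ) - (1 + γ) * Real.sqrt (Δ : ℝ)
  have hA := le_cutCard_of_outDeg_le hG ho A fun u hu => (Finset.mem_filter.1 hu).2
  have hB := le_cutCard_of_outDeg_le hG ho.flip Aᶜ
    (r := ρ₂ * (Δ : ℝ) - (1 + γ) * Real.sqrt (Δ : ℝ)) fun u hu =>
      (hdeg u).resolve_left fun h => Finset.mem_compl.1 hu (by simpa [A] using h)
  have hA' : (cutCard G A : ℝ) ≤ A.card * Δ := mod_cast cutCard_le_mul_card hG A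
  have hB' : (cutCard G Aᶜ : ℝ) ≤ Aᶜ.card * Δ := mod_cast cutCard_le_mul_card hG Aᶜ
  have hAB : (A.card : ℝ) + Aᶜ.card = n := by
    rw [← hV]
    exact_mod_cast A.card_add_card_compl
  have hm := hcut A
  rw [cutCard_compl] at hB hB'
  rw [← hAB, add_sub_cancel_left, hAB] at hm
  have hn' : (1 : ℝ) ≤ n := mod_cast hn
  have hΔ' : (1 : ℝ) ≤ Δ := mod_cast hΔ
  have hs : Real.sqrt Δ * Real.sqrt Δ = Δ := Real.mul_self_sqrt (by linarith)
  have hs0 : 0 < Real.sqrt Δ := Real.sqrt_pos.2 (by linarith)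
  have hsn : Real.sqrt n ≤ n := Real.sqrt_le_iff.2 ⟨by linarith, by nlinarith⟩
  have ha0 : (0 : ℝ) ≤ A.card := Nat.cast_nonneg _
  have hb0 : (0 : ℝ) ≤ Aᶜ.card := Nat.cast_nonneg _
  generalize (A.card : ℝ) = a at *
  generalize (Aᶜ.card : ℝ) = b at *
  generalize (cutCard G A : ℝ) = m at *
  generalize Real.sqrt Δ = s at *
  generalize Real.sqrt n = t at *
  generalize (n : ℝ) = N at *
  generalize (Δ : ℝ) = D at *
  obtain rfl : ρ₂ = 1 / 2 - ρ₁ := by linarith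
  subst hs
  have h1 : 2 * (1 + γ) * a ≤ b * s := by
    refine le_of_mul_le_mul_right ?_ hs0
    nlinarith [mul_nonneg (mul_nonneg ha0 hρ₂) (mul_nonneg hs0.le hs0.le)]
  have h2 : 2 * (1 + γ) * b ≤ a * s := by
    refine le_of_mul_le_mul_right ?_ hs0
    nlinarith [mul_nonneg (mul_nonneg hb0 hρ₁) (mul_nonneg hs0.le hs0.le)]
  have hlow : (1 + γ) * N ^ 2 ≤ 2 * (a * b * s) := by
    subst hAB
    have hsq : (1 + γ) * (a + b) ^ 2 ≤ (1 + γ) * (2 * (a ^ 2 + b ^ 2)) :=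
      mul_le_mul_of_nonneg_left (by nlinarith [sq_nonneg (a - b)]) (by linarith)
    nlinarith [mul_le_mul_of_nonneg_left h1 ha0, mul_le_mul_of_nonneg_left h2 hb0]
  have hN : 0 < N := by linarith
  have hup : (1 + 4 * γ) * (a * b * s) ≤ γ * N ^ 2 := by
    have hm' : N * m ≤ a * b * (s * s + 3 * s) + γ * t * N := by
      calc N * m ≤ N * (a * b / N * (s * s + 3 * s) + γ * t) :=
            mul_le_mul_of_nonneg_left hm hN.le
        _ = _ := by field_simp
    have ht : γ * t * N ≤ γ * N * N :=
      mul_le_mul_of_nonneg_right (mul_le_mul_of_nonneg_left hsn hγ.le) hN.le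
    have hN_eq : N * m = a * m + b * m := by rw [← hAB]; ring
    nlinarith [mul_le_mul_of_nonneg_left hA hb0, mul_le_mul_of_nonneg_left hB ha0]
  nlinarith [mul_le_mul_of_nonneg_left hlow (by linarith : (0 : ℝ) ≤ 1 + 4 * γ),
    mul_pos hN hN, mul_pos hγ (mul_pos hN hN), mul_pos hγ (mul_pos hγ (mul_pos hN hN))]
end

section
/- Let G be a simple graph on a finite vertex set V with n = |V| ≥ 1, let L be the Laplacian matrix of G, and let λ ∈ ℝ be such that xᵀLx ≤ λ·xᵀx for every x ∈ ℝ^V. Then for every subset C ⊆ V, e(C, V∖C) ≤ λ·|C|·(n − |C|)/n. -/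
/-- The cut size as a double sum of indicators over ordered pairs of vertices. -/
lemma cutCard_eq_sum_s13 {V : Type} [Fintype V] [DecidableEq V] (G : SimpleGraph V)
    [DecidableRel G.Adj] (C : Finset V) :
    (cutCard G C : ℝ) =
      ∑ i : V, ∑ j : V, if G.Adj i j then (if i ∈ C ∧ j ∉ C then 1 else 0) else 0 := by
  have hcard : cutCard G C =
      (Finset.univ.filter (fun p : V × V => G.Adj p.1 p.2 ∧ p.1 ∈ C ∧ p.2 ∉ C)).card := by
    refine Finset.card_bij (fun d _ => d.toProd) ?_ ?_ ?_
    · intro d hd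
      simpa [d.adj] using hd
    · intro d _ d' _ h
      exact SimpleGraph.Dart.ext d d' h
    · intro p hp
      simp only [Finset.mem_filter, Finset.mem_univ, true_and] at hp
      exact ⟨⟨p, hp.1⟩, by simpa using hp.2, rfl⟩
  rw [hcard, ← Fintype.sum_prod_type', Finset.card_filter]
  push_cast
  simp only [ite_and]

open Matrix in
/-- The Laplacian quadratic form at a shifted indicator vector of `C` is the cut size of `C`. -/
lemma dotProduct_lapMatrix_mulVec_indicator_sub {V : Type} [Fintype V] [DecidableEq V]
    (G : SimpleGraph V) [DecidableRel G.Adj] (C : Finset V) (a : ℝ) :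
    (fun v => (if v ∈ C then (1 : ℝ) else 0) - a) ⬝ᵥ
      (G.lapMatrix ℝ).mulVec (fun v => (if v ∈ C then (1 : ℝ) else 0) - a) = cutCard G C := by
  rw [← Matrix.toLinearMap₂'_apply', SimpleGraph.lapMatrix_toLinearMap₂',
    div_eq_iff two_ne_zero, mul_two]
  have hswap : (cutCard G C : ℝ) =
      ∑ i : V, ∑ j : V, if G.Adj i j then (if j ∈ C ∧ i ∉ C then 1 else 0) else 0 := by
    rw [cutCard_eq_sum_s13, Finset.sum_comm]
    simp only [G.adj_comm]
  nth_rw 2 [hswap]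
  rw [cutCard_eq_sum_s13, ← Finset.sum_add_distrib]
  refine Finset.sum_congr rfl fun i _ => ?_
  rw [← Finset.sum_add_distrib]
  refine Finset.sum_congr rfl fun j _ => ?_
  rw [sub_sub_sub_cancel_right]
  by_cases hi : i ∈ C <;> by_cases hj : j ∈ C <;> simp [hi, hj]

open Matrix in
/-- The squared norm of the indicator vector of `C` shifted by a constant. -/
lemma dotProduct_indicator_sub_self {V : Type} [Fintype V] [DecidableEq V]
    (C : Finset V) (a : ℝ) :
    (fun v => (if v ∈ C then (1 : ℝ) else 0) - a) ⬝ᵥ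
      (fun v => (if v ∈ C then (1 : ℝ) else 0) - a) =
        (C.card : ℝ) - 2 * a * C.card + Fintype.card V * a ^ 2 := by
  have h : ∀ v : V, ((if v ∈ C then (1 : ℝ) else 0) - a) * ((if v ∈ C then (1 : ℝ) else 0) - a) =
      (1 - 2 * a) * (if v ∈ C then (1 : ℝ) else 0) + a ^ 2 := by
    intro v
    split_ifs <;> ring
  simp only [dotProduct, h, Finset.sum_add_distrib, ← Finset.mul_sum]
  simp
  ring

open Matrix in
/-- Let `G` be a simple graph on a finite nonempty vertex set `V`
with `n = |V|`, let `L` be its Laplacian matrix, and suppose `xᵀLx ≤ λ·xᵀx` for every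
`x ∈ ℝ^V`.  Then for every `C ⊆ V`, `e(C, V∖C) ≤ λ·|C|·(n - |C|)/n`. -/
theorem cut_upper_bound_of_laplacian {V : Type} [Fintype V] [DecidableEq V]
    (G : SimpleGraph V) [DecidableRel G.Adj]
    (hn : 1 ≤ Fintype.card V) (lam : ℝ)
    (hlam : ∀ x : V → ℝ, x ⬝ᵥ (G.lapMatrix ℝ).mulVec x ≤ lam * (x ⬝ᵥ x)) :
    ∀ C : Finset V,
      (cutCard G C : ℝ) ≤
        lam * (C.card : ℝ) * ((Fintype.card V : ℝ) - (C.card : ℝ)) /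
          (Fintype.card V : ℝ) := by
  intro C
  have hn0 : (Fintype.card V : ℝ) ≠ 0 := by
    exact_mod_cast Nat.one_le_iff_ne_zero.mp hn
  have h := hlam fun v => (if v ∈ C then (1 : ℝ) else 0) - C.card / Fintype.card V
  rw [dotProduct_lapMatrix_mulVec_indicator_sub, dotProduct_indicator_sub_self] at h
  refine h.trans_eq ?_
  field_simp
  ring
end
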